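/- arXiv:1904.07049 — 4 statements merged into one kernel-verified Lean document; each statement's English description precedes it below -/
import Mathlib

section
/- Equip V as trial space with the norm ‖·‖ and as test space with the norm ‖·‖_α. Then the bilinear form b satisfies: (i) |b(v,φ)| ≤ ‖v‖·‖φ‖_α for all v, φ ∈ V; (ii) for every φ ∈ V there exists v ∈ V with ‖v‖ ≤ (1+γ)‖φ‖ and b(v,φ) ≥ ((1+L)/(1+2L))·(m_a/M_a)·‖φ‖_α·‖φ‖, and hence b(v,φ) ≥ (1/κ)·(m_a/M_a)·‖v‖·‖φ‖_α. Consequently the continuity constant M_b and the inf-sup constant m_b = inf_{φ≠0} sup_{v≠0} b(v,φ)/(‖v‖·‖φ‖_α) of b satisfy 0 < (1/κ)(m_a/M_a) ≤ m_b ≤ M_b ≤ 1. -/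
open scoped RealInnerProductSpace
open Filter Topology

noncomputable section Setup

variable {V₁ V₂ Q W : Type*}
  [NormedAddCommGroup V₁] [InnerProductSpace ℝ V₁]
  [NormedAddCommGroup V₂] [InnerProductSpace ℝ V₂]
  [NormedAddCommGroup Q] [InnerProductSpace ℝ Q]
  [NormedAddCommGroup W] [InnerProductSpace ℝ W]

/-- The ℓ²-norm on the product space `V = V₁ × V₂`. -/
def nV (v : V₁ × V₂) : ℝ := Real.sqrt (‖v.1‖ ^ 2 + ‖v.2‖ ^ 2)

/-- The seminorm `|v| = (‖I v₁‖² + ‖C* v₂‖²)^{1/2}`. -/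
def sV (Cs : V₂ →L[ℝ] Q) (Iop : V₁ →L[ℝ] W) (v : V₁ × V₂) : ℝ :=
  Real.sqrt (‖Iop v.1‖ ^ 2 + ‖Cs v.2‖ ^ 2)

/-- The vectorized bilinear form `a(v,φ) = a(v₁,φ₂) + a(φ₁,v₂)` on `V × V`. -/
def aV (a : V₁ →L[ℝ] V₂ →L[ℝ] ℝ) (v φ : V₁ × V₂) : ℝ := a v.1 φ.2 + a φ.1 v.2

/-- The bilinear form `b = a + α^{-1/2} c` of the rescaled reduced optimality system. -/
def bV (a : V₁ →L[ℝ] V₂ →L[ℝ] ℝ) (Cs : V₂ →L[ℝ] Q) (Iop : V₁ →L[ℝ] W) (α : ℝ)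
    (v φ : V₁ × V₂) : ℝ :=
  aV a v φ + (Real.sqrt α)⁻¹ * (⟪Cs v.2, Cs φ.2⟫ - ⟪Iop v.1, Iop φ.1⟫)

/-- Continuity constant `M_a = sup { a(v₁,v₂) : ‖v₁‖ = 1, ‖v₂‖ = 1 }`. -/
def contConst (a : V₁ →L[ℝ] V₂ →L[ℝ] ℝ) : ℝ :=
  sSup {r : ℝ | ∃ v₁ : V₁, ∃ v₂ : V₂, ‖v₁‖ = 1 ∧ ‖v₂‖ = 1 ∧ r = a v₁ v₂}

/-- Inf-sup constant `m_a = inf_{‖v₂‖=1} sup_{‖v₁‖=1} a(v₁,v₂)`. -/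
def infSupConst (a : V₁ →L[ℝ] V₂ →L[ℝ] ℝ) : ℝ :=
  sInf {r : ℝ | ∃ v₂ : V₂, ‖v₂‖ = 1 ∧
    r = sSup {s : ℝ | ∃ v₁ : V₁, ‖v₁‖ = 1 ∧ s = a v₁ v₂}}

/-- The α-dependent test norm `‖φ‖_α = M_a ‖φ‖ + (M/√α) |φ|`. -/
def nAlpha (Cs : V₂ →L[ℝ] Q) (Iop : V₁ →L[ℝ] W) (M_a M α : ℝ) (φ : V₁ × V₂) : ℝ :=
  M_a * nV φ + (M / Real.sqrt α) * sV Cs Iop φ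

end Setup

section ProductNorm

variable {V₁ V₂ Q W : Type*}
  [NormedAddCommGroup V₁] [NormedAddCommGroup V₂] [NormedAddCommGroup Q] [NormedAddCommGroup W]

lemma nV_eq_norm_toLp (v : V₁ × V₂) : nV v = ‖WithLp.toLp 2 v‖ := by
  rw [WithLp.prod_norm_eq_of_L2]
  rfl

lemma nV_nonneg (v : V₁ × V₂) : 0 ≤ nV v := Real.sqrt_nonneg _

lemma nV_sq (v : V₁ × V₂) : nV v ^ 2 = ‖v.1‖ ^ 2 + ‖v.2‖ ^ 2 :=
  Real.sq_sqrt (by positivity)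

lemma nV_pos {v : V₁ × V₂} (hv : v ≠ 0) : 0 < nV v := by
  rw [nV_eq_norm_toLp, norm_pos_iff]
  simpa using hv

lemma nV_add_le (v w : V₁ × V₂) : nV (v + w) ≤ nV v + nV w := by
  simpa only [nV_eq_norm_toLp, WithLp.toLp_add] using
    norm_add_le (WithLp.toLp 2 v) (WithLp.toLp 2 w)

lemma nV_neg_fst (v : V₁ × V₂) : nV (-v.1, v.2) = nV v := by simp [nV]

lemma mul_add_mul_le_nV (v : V₁ × V₂) (φ : Q × W) :
    ‖v.1‖ * ‖φ.1‖ + ‖v.2‖ * ‖φ.2‖ ≤ nV v * nV φ := by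
  apply le_of_sq_le_sq _ (mul_nonneg (nV_nonneg v) (nV_nonneg φ))
  rw [mul_pow, nV_sq, nV_sq]
  nlinarith [sq_nonneg (‖v.1‖ * ‖φ.2‖ - ‖v.2‖ * ‖φ.1‖)]

lemma nV_swap (v : V₁ × V₂) : nV v.swap = nV v := by
  simp [nV, add_comm]

end ProductNorm

section Seminorm

variable {V₁ V₂ Q W : Type*}
  [NormedAddCommGroup V₁] [InnerProductSpace ℝ V₁]
  [NormedAddCommGroup V₂] [InnerProductSpace ℝ V₂]
  [NormedAddCommGroup Q] [InnerProductSpace ℝ Q]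
  [NormedAddCommGroup W] [InnerProductSpace ℝ W]

lemma nV_smul_of_nonneg {t : ℝ} (ht : 0 ≤ t) (v : V₁ × V₂) : nV (t • v) = t * nV v := by
  rw [nV_eq_norm_toLp, nV_eq_norm_toLp, WithLp.toLp_smul, norm_smul, Real.norm_of_nonneg ht]

lemma sV_eq_nV (Cs : V₂ →L[ℝ] Q) (Iop : V₁ →L[ℝ] W) (v : V₁ × V₂) :
    sV Cs Iop v = nV (Iop v.1, Cs v.2) := rfl

lemma sV_le {Cs : V₂ →L[ℝ] Q} {Iop : V₁ →L[ℝ] W} {M : ℝ} (hI : ‖Iop‖ ≤ M) (hC : ‖Cs‖ ≤ M)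
    (v : V₁ × V₂) : sV Cs Iop v ≤ M * nV v := by
  have hM : 0 ≤ M := (norm_nonneg _).trans hI
  apply le_of_sq_le_sq _ (mul_nonneg hM (nV_nonneg v))
  rw [sV_eq_nV, mul_pow, nV_sq, nV_sq, mul_add, ← mul_pow, ← mul_pow]
  gcongr
  · exact Iop.le_of_opNorm_le hI _
  · exact Cs.le_of_opNorm_le hC _

lemma abs_inner_sub_inner_le (Cs : V₂ →L[ℝ] Q) (Iop : V₁ →L[ℝ] W) (v φ : V₁ × V₂) :
    |⟪Cs v.2, Cs φ.2⟫ - ⟪Iop v.1, Iop φ.1⟫| ≤ sV Cs Iop v * sV Cs Iop φ := by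
  have h := mul_add_mul_le_nV (Iop v.1, Cs v.2) (Iop φ.1, Cs φ.2)
  have h₁ := abs_real_inner_le_norm (Cs v.2) (Cs φ.2)
  have h₂ := abs_real_inner_le_norm (Iop v.1) (Iop φ.1)
  rw [sV_eq_nV, sV_eq_nV]
  exact (abs_sub _ _).trans (by linarith)

lemma bV_neg_fst_self (a : V₁ →L[ℝ] V₂ →L[ℝ] ℝ) (Cs : V₂ →L[ℝ] Q) (Iop : V₁ →L[ℝ] W) (α : ℝ)
    (φ : V₁ × V₂) :
    bV a Cs Iop α (-φ.1, φ.2) φ = (Real.sqrt α)⁻¹ * sV Cs Iop φ ^ 2 := by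
  rw [sV_eq_nV, nV_sq]
  simp only [bV, aV, map_neg, neg_apply, inner_neg_left,
    real_inner_self_eq_norm_sq]
  ring

lemma bV_add_smul_left (a : V₁ →L[ℝ] V₂ →L[ℝ] ℝ) (Cs : V₂ →L[ℝ] Q) (Iop : V₁ →L[ℝ] W)
    (α t : ℝ) (v w φ : V₁ × V₂) :
    bV a Cs Iop α (v + t • w) φ = bV a Cs Iop α v φ + t * bV a Cs Iop α w φ := by
  simp [bV, aV, inner_add_left, real_inner_smul_left]
  ring

end Seminorm

section InfSup

variable {V₁ V₂ : Type*}
  [NormedAddCommGroup V₁] [InnerProductSpace ℝ V₁]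
  [NormedAddCommGroup V₂] [InnerProductSpace ℝ V₂]

lemma apply_le_opNorm_of_norm_eq_one (a : V₁ →L[ℝ] V₂ →L[ℝ] ℝ) {v₁ : V₁} {v₂ : V₂}
    (h₁ : ‖v₁‖ = 1) (h₂ : ‖v₂‖ = 1) : a v₁ v₂ ≤ ‖a‖ := by
  have h := a.le_opNorm₂ v₁ v₂
  rw [h₁, h₂, mul_one, mul_one] at h
  exact (le_abs_self _).trans h

lemma bddAbove_contConst_set (a : V₁ →L[ℝ] V₂ →L[ℝ] ℝ) :
    BddAbove {r : ℝ | ∃ v₁ : V₁, ∃ v₂ : V₂, ‖v₁‖ = 1 ∧ ‖v₂‖ = 1 ∧ r = a v₁ v₂} := by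
  refine ⟨‖a‖, ?_⟩
  rintro _ ⟨v₁, v₂, h₁, h₂, rfl⟩
  exact apply_le_opNorm_of_norm_eq_one a h₁ h₂

lemma apply_le_contConst (a : V₁ →L[ℝ] V₂ →L[ℝ] ℝ) (v₁ : V₁) (v₂ : V₂) :
    a v₁ v₂ ≤ contConst a * (‖v₁‖ * ‖v₂‖) := by
  rcases eq_or_ne v₁ 0 with rfl | h₁
  · simp
  rcases eq_or_ne v₂ 0 with rfl | h₂
  · simp
  have h : a (‖v₁‖⁻¹ • v₁) (‖v₂‖⁻¹ • v₂) ≤ contConst a :=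
    le_csSup (bddAbove_contConst_set a)
      ⟨_, _, norm_smul_inv_norm (𝕜 := ℝ) h₁, norm_smul_inv_norm (𝕜 := ℝ) h₂, rfl⟩
  have hp₁ := norm_pos_iff.2 h₁
  have hp₂ := norm_pos_iff.2 h₂
  simp only [map_smul, smul_apply, smul_eq_mul] at h
  calc a v₁ v₂ = ‖v₂‖⁻¹ * (‖v₁‖⁻¹ * a v₁ v₂) * (‖v₁‖ * ‖v₂‖) := by field_simp
    _ ≤ _ := by gcongr

lemma abs_apply_le_contConst (a : V₁ →L[ℝ] V₂ →L[ℝ] ℝ) (v₁ : V₁) (v₂ : V₂) :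
    |a v₁ v₂| ≤ contConst a * (‖v₁‖ * ‖v₂‖) := by
  refine abs_le.2 ⟨?_, apply_le_contConst a v₁ v₂⟩
  have h := apply_le_contConst a (-v₁) v₂
  simp only [map_neg, neg_apply, norm_neg] at h
  linarith

/-- If the infimum is positive it is not the default value of an unbounded set. -/
lemma infSupConst_le (a : V₁ →L[ℝ] V₂ →L[ℝ] ℝ) (h : 0 < infSupConst a) {v₂ : V₂}
    (hv₂ : ‖v₂‖ = 1) :
    infSupConst a ≤ sSup {s : ℝ | ∃ v₁ : V₁, ‖v₁‖ = 1 ∧ s = a v₁ v₂} := by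
  refine csInf_le ?_ ⟨v₂, hv₂, rfl⟩
  by_contra hb
  exact h.ne' (Real.sInf_of_not_bddBelow hb)

lemma exists_norm_eq_one_lt_apply [Nontrivial V₁] (a : V₁ →L[ℝ] V₂ →L[ℝ] ℝ)
    (h : 0 < infSupConst a) {v₂ : V₂} (hv₂ : ‖v₂‖ = 1) {ε : ℝ} (hε : ε < infSupConst a) :
    ∃ v₁ : V₁, ‖v₁‖ = 1 ∧ ε < a v₁ v₂ := by
  obtain ⟨u, hu⟩ := exists_norm_eq V₁ zero_le_one
  obtain ⟨_, ⟨v₁, h₁, rfl⟩, hlt⟩ :=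
    exists_lt_of_lt_csSup (s := {s : ℝ | ∃ v₁ : V₁, ‖v₁‖ = 1 ∧ s = a v₁ v₂}) ⟨_, u, hu, rfl⟩
      (hε.trans_le (infSupConst_le a h hv₂))
  exact ⟨v₁, h₁, hlt⟩

lemma infSupConst_le_contConst [Nontrivial V₁] [Nontrivial V₂] (a : V₁ →L[ℝ] V₂ →L[ℝ] ℝ)
    (h : 0 < infSupConst a) : infSupConst a ≤ contConst a := by
  obtain ⟨u, hu⟩ := exists_norm_eq V₂ zero_le_one
  refine le_of_forall_lt fun ε hε => ?_
  obtain ⟨v₁, h₁, hlt⟩ := exists_norm_eq_one_lt_apply a h hu hε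
  exact hlt.trans_le (le_csSup (bddAbove_contConst_set a) ⟨v₁, u, h₁, hu, rfl⟩)

lemma infSupConst_mul_norm_le [Nontrivial V₁] (a : V₁ →L[ℝ] V₂ →L[ℝ] ℝ)
    (h : 0 < infSupConst a) (v₂ : V₂) : infSupConst a * ‖v₂‖ ≤ ‖a.flip v₂‖ := by
  rcases eq_or_ne v₂ 0 with rfl | h₂
  · simp
  have hp := norm_pos_iff.2 h₂
  rw [← le_div_iff₀ hp]
  refine le_of_forall_lt fun ε hε => ?_
  obtain ⟨v₁, h₁, hlt⟩ :=
    exists_norm_eq_one_lt_apply a h (norm_smul_inv_norm (𝕜 := ℝ) h₂) hε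
  refine hlt.trans_le ?_
  rw [le_div_iff₀ hp]
  have hle := (le_abs_self _).trans ((a.flip v₂).le_opNorm v₁)
  simp only [map_smul, smul_eq_mul, h₁, mul_one, ContinuousLinearMap.flip_apply] at hle ⊢
  calc _ = a v₁ v₂ := by
        simp only [RCLike.ofReal_real_eq_id, id]
        field_simp
    _ ≤ _ := hle

variable [CompleteSpace V₁]

/-- Normalised maximisation in the first argument. -/
lemma exists_fst_apply_eq [Nontrivial V₁] (a : V₁ →L[ℝ] V₂ →L[ℝ] ℝ)
    (h : 0 < infSupConst a) (φ₂ : V₂) :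
    ∃ w₁ : V₁, ‖w₁‖ ≤ ‖φ₂‖ ∧ a w₁ φ₂ = infSupConst a * ‖φ₂‖ ^ 2 := by
  rcases eq_or_ne φ₂ 0 with rfl | h₂
  · exact ⟨0, by simp⟩
  have hp := norm_pos_iff.2 h₂
  have hle := infSupConst_mul_norm_le a h φ₂
  set R := (InnerProductSpace.toDual ℝ V₁).symm (a.flip φ₂) with hR
  have hRn : ‖R‖ = ‖a.flip φ₂‖ := LinearIsometryEquiv.norm_map _ _
  have hRa : a R φ₂ = ‖R‖ ^ 2 := by
    rw [← real_inner_self_eq_norm_sq]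
    conv_rhs => rw [hR, InnerProductSpace.toDual_symm_apply]
    rfl
  rw [← hRn] at hle
  have hRp : 0 < ‖R‖ := (mul_pos h hp).trans_le hle
  refine ⟨(infSupConst a * ‖φ₂‖ ^ 2 / ‖R‖ ^ 2) • R, ?_, ?_⟩
  · rw [norm_smul, Real.norm_of_nonneg (by positivity)]
    calc _ = infSupConst a * ‖φ₂‖ * ‖φ₂‖ / ‖R‖ := by field_simp
      _ ≤ ‖R‖ * ‖φ₂‖ / ‖R‖ := by gcongr
      _ = ‖φ₂‖ := by field_simp
  · simp only [map_smul, smul_apply, smul_eq_mul, hRa]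
    field_simp

/-- Under nondegeneracy the inf-sup condition transfers to the second argument: the operator
`V₂ → V₁` representing `a` is bounded below with dense range, hence onto. -/
lemma exists_snd_apply_eq [Nontrivial V₁] [CompleteSpace V₂] (a : V₁ →L[ℝ] V₂ →L[ℝ] ℝ)
    (h : 0 < infSupConst a) (hnd : ∀ v₁ : V₁, (∀ v₂ : V₂, a v₁ v₂ = 0) → v₁ = 0) (φ₁ : V₁) :
    ∃ w₂ : V₂, ‖w₂‖ ≤ ‖φ₁‖ ∧ a φ₁ w₂ = infSupConst a * ‖φ₁‖ ^ 2 := by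
  let T : V₂ →L⋆[ℝ] V₁ :=
    ((InnerProductSpace.toDual ℝ V₁).symm.toContinuousLinearEquiv :
      StrongDual ℝ V₁ →L⋆[ℝ] V₁).comp a.flip
  have hTa (v₂ : V₂) (v₁ : V₁) : ⟪T v₂, v₁⟫ = a v₁ v₂ :=
    InnerProductSpace.toDual_symm_apply
  have hTn (v₂ : V₂) : infSupConst a * ‖v₂‖ ≤ ‖T v₂‖ :=
    (infSupConst_mul_norm_le a h v₂).trans_eq
      ((InnerProductSpace.toDual ℝ V₁).symm.norm_map (a.flip v₂)).symm
  have hanti : AntilipschitzWith (Real.toNNReal (infSupConst a)⁻¹) T := by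
    refine T.antilipschitz_of_bound fun x => ?_
    rw [Real.coe_toNNReal _ (by positivity), ← div_eq_inv_mul, le_div_iff₀ h, mul_comm]
    exact hTn x
  have hclosed : IsClosed (T.range : Set V₁) :=
    hanti.isClosed_range T.uniformContinuous
  have : CompleteSpace T.range := hclosed.completeSpace_coe
  have htop : T.range = ⊤ := by
    rw [← Submodule.orthogonal_eq_bot_iff, Submodule.eq_bot_iff]
    intro x hx
    refine hnd x fun v₂ => ?_
    rw [← hTa]
    exact hx _ ⟨v₂, rfl⟩
  obtain ⟨z, hz⟩ : φ₁ ∈ T.range := htop ▸ Submodule.mem_top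
  replace hz : T z = φ₁ := hz
  refine ⟨infSupConst a • z, ?_, ?_⟩
  · rw [norm_smul, Real.norm_of_nonneg h.le, ← hz]
    exact hTn z
  · rw [map_smul, smul_eq_mul, ← hTa, hz, real_inner_self_eq_norm_sq]

lemma exists_nV_le_aV_eq [Nontrivial V₁] [CompleteSpace V₂] (a : V₁ →L[ℝ] V₂ →L[ℝ] ℝ)
    (h : 0 < infSupConst a) (hnd : ∀ v₁ : V₁, (∀ v₂ : V₂, a v₁ v₂ = 0) → v₁ = 0)
    (φ : V₁ × V₂) : ∃ w : V₁ × V₂, nV w ≤ nV φ ∧ aV a w φ = infSupConst a * nV φ ^ 2 := by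
  obtain ⟨w₁, hw₁, ha₁⟩ := exists_fst_apply_eq a h φ.2
  obtain ⟨w₂, hw₂, ha₂⟩ := exists_snd_apply_eq a h hnd φ.1
  refine ⟨(w₁, w₂), ?_, ?_⟩
  · rw [nV, nV, add_comm (‖φ.1‖ ^ 2)]
    gcongr
  · rw [aV, ha₁, ha₂, nV_sq]
    ring

end InfSup

section Estimates

variable {V₁ V₂ Q W : Type*}
  [NormedAddCommGroup V₁] [InnerProductSpace ℝ V₁]
  [NormedAddCommGroup V₂] [InnerProductSpace ℝ V₂]
  [NormedAddCommGroup Q] [InnerProductSpace ℝ Q]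
  [NormedAddCommGroup W] [InnerProductSpace ℝ W]
  (a : V₁ →L[ℝ] V₂ →L[ℝ] ℝ) {Cs : V₂ →L[ℝ] Q} {Iop : V₁ →L[ℝ] W} {M : ℝ}

lemma abs_aV_le [Nontrivial V₁] [Nontrivial V₂] (h : 0 < infSupConst a) (v φ : V₁ × V₂) :
    |aV a v φ| ≤ contConst a * (nV v * nV φ) := by
  have h₁ := abs_apply_le_contConst a v.1 φ.2
  have h₂ := abs_apply_le_contConst a φ.1 v.2
  have hM : 0 ≤ contConst a := (h.trans_le (infSupConst_le_contConst a h)).le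
  have h₃ := mul_add_mul_le_nV v φ.swap
  rw [nV_swap] at h₃
  simp only [Prod.fst_swap, Prod.snd_swap] at h₃
  refine (abs_add_le _ _).trans ?_
  calc _ ≤ contConst a * (‖v.1‖ * ‖φ.2‖ + ‖v.2‖ * ‖φ.1‖) := by linarith
    _ ≤ _ := by gcongr

lemma abs_inner_sub_inner_le_mul (hI : ‖Iop‖ ≤ M) (hC : ‖Cs‖ ≤ M) (v φ : V₁ × V₂) :
    |⟪Cs v.2, Cs φ.2⟫ - ⟪Iop v.1, Iop φ.1⟫| ≤ M * nV v * sV Cs Iop φ :=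
  (abs_inner_sub_inner_le Cs Iop v φ).trans
    (mul_le_mul_of_nonneg_right (sV_le hI hC v) (Real.sqrt_nonneg _))

lemma abs_bV_le [Nontrivial V₁] [Nontrivial V₂] (h : 0 < infSupConst a)
    (hI : ‖Iop‖ ≤ M) (hC : ‖Cs‖ ≤ M) (α : ℝ) (v φ : V₁ × V₂) :
    |bV a Cs Iop α v φ| ≤ nV v * nAlpha Cs Iop (contConst a) M α φ := by
  have hc := abs_inner_sub_inner_le_mul hI hC v φ
  have hs : 0 ≤ (Real.sqrt α)⁻¹ := by positivity
  refine (abs_add_le _ _).trans ?_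
  rw [abs_mul, abs_of_nonneg hs]
  calc _ ≤ contConst a * (nV v * nV φ) + (Real.sqrt α)⁻¹ * (M * nV v * sV Cs Iop φ) := by
        gcongr
        exact abs_aV_le a h v φ
    _ = _ := by rw [nAlpha]; ring

/-- The difference of the two sides, times `(1 + 2 * L) * m`, is
`L * ((m * x - (1 + 2 * L) * y) ^ 2 + L * (m * x) * y)`. -/
lemma weighted_young {L m x y : ℝ} (hL : 0 ≤ L) (hm : 0 < m) (hx : 0 ≤ x) (hy : 0 ≤ y) :
    (1 + L) / (1 + 2 * L) * ((m * x + L * y) * x) ≤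
      m * x ^ 2 - L * x * y + L / m * (1 + 2 * L) * y ^ 2 := by
  have key : m * x ^ 2 - L * x * y + L / m * (1 + 2 * L) * y ^ 2 -
      (1 + L) / (1 + 2 * L) * ((m * x + L * y) * x) =
      L * ((m * x - (1 + 2 * L) * y) ^ 2 + L * (m * x) * y) / ((1 + 2 * L) * m) := by
    field_simp
    ring
  have : 0 ≤ L * ((m * x - (1 + 2 * L) * y) ^ 2 + L * (m * x) * y) / ((1 + 2 * L) * m) := by
    positivity
  linarith

lemma exists_nV_le_le_bV [CompleteSpace V₁] [CompleteSpace V₂] [Nontrivial V₁] [Nontrivial V₂]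
    (h : 0 < infSupConst a) (hnd : ∀ v₁ : V₁, (∀ v₂ : V₂, a v₁ v₂ = 0) → v₁ = 0)
    (hI : ‖Iop‖ ≤ M) (hC : ‖Cs‖ ≤ M) (α : ℝ) {L γ : ℝ} (hL : L = M / Real.sqrt α)
    (hγ : γ = M / infSupConst a * (1 + 2 * L)) (φ : V₁ × V₂) :
    ∃ v : V₁ × V₂, nV v ≤ (1 + γ) * nV φ ∧
      (1 + L) / (1 + 2 * L) * (infSupConst a / contConst a) *
        (nAlpha Cs Iop (contConst a) M α φ * nV φ) ≤ bV a Cs Iop α v φ := by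
  have hM : 0 ≤ M := (norm_nonneg _).trans hI
  have hL0 : 0 ≤ L := hL ▸ by positivity
  have hγ0 : 0 ≤ γ := hγ ▸ by positivity
  have hle := infSupConst_le_contConst a h
  have hMa : 0 < contConst a := h.trans_le hle
  have hx := nV_nonneg φ
  have hy : 0 ≤ sV Cs Iop φ := Real.sqrt_nonneg _
  obtain ⟨w, hw, haw⟩ := exists_nV_le_aV_eq a h hnd φ
  refine ⟨w + γ • (-φ.1, φ.2), ?_, ?_⟩
  · have := nV_add_le w (γ • (-φ.1, φ.2))
    rw [nV_smul_of_nonneg hγ0, nV_neg_fst] at this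
    linarith
  · rw [bV_add_smul_left, bV_neg_fst_self, bV, haw]
    have hc := (neg_le_of_abs_le (abs_inner_sub_inner_le_mul hI hC w φ))
    have hc' : -(L * nV φ * sV Cs Iop φ) ≤
        (Real.sqrt α)⁻¹ * (⟪Cs w.2, Cs φ.2⟫ - ⟪Iop w.1, Iop φ.1⟫) := by
      calc -(L * nV φ * sV Cs Iop φ)
          ≤ -(L * nV w * sV Cs Iop φ) := by gcongr
        _ = (Real.sqrt α)⁻¹ * -(M * nV w * sV Cs Iop φ) := by rw [hL]; ring
        _ ≤ _ := by gcongr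
    have hγ' : γ * ((Real.sqrt α)⁻¹ * sV Cs Iop φ ^ 2) =
        L / infSupConst a * (1 + 2 * L) * sV Cs Iop φ ^ 2 := by
      rw [hγ]
      nth_rewrite 2 [hL]
      ring
    have hscale : infSupConst a / contConst a * nAlpha Cs Iop (contConst a) M α φ ≤
        infSupConst a * nV φ + L * sV Cs Iop φ := by
      have h₁ : infSupConst a / contConst a ≤ 1 := (div_le_one hMa).2 hle
      calc _ = infSupConst a * nV φ +
            infSupConst a / contConst a * (L * sV Cs Iop φ) := by
            rw [nAlpha, ← hL]; field_simp
        _ ≤ _ := by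
            exact add_le_add_right (mul_le_of_le_one_left (by positivity) h₁) _
    calc _ = (1 + L) / (1 + 2 * L) *
          (infSupConst a / contConst a * nAlpha Cs Iop (contConst a) M α φ * nV φ) := by ring
      _ ≤ (1 + L) / (1 + 2 * L) * ((infSupConst a * nV φ + L * sV Cs Iop φ) * nV φ) := by
          gcongr
      _ ≤ _ := weighted_young hL0 h hx hy
      _ ≤ _ := by linarith

end Estimates

/-- Theorem 2.1, bilinear form of the reduced optimality system:
continuity with constant 1 w.r.t. the trial norm `‖·‖` and the test norm `‖·‖_α`,
the inf-sup ansatz estimate, and `0 < (1/κ)(m_a/M_a) ≤ m_b ≤ M_b ≤ 1`. -/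
theorem stmt0
    {V₁ V₂ Q W : Type*}
    [NormedAddCommGroup V₁] [InnerProductSpace ℝ V₁] [CompleteSpace V₁] [Nontrivial V₁]
    [NormedAddCommGroup V₂] [InnerProductSpace ℝ V₂] [CompleteSpace V₂] [Nontrivial V₂]
    [NormedAddCommGroup Q] [InnerProductSpace ℝ Q] [CompleteSpace Q]
    [NormedAddCommGroup W] [InnerProductSpace ℝ W] [CompleteSpace W]
    (a : V₁ →L[ℝ] V₂ →L[ℝ] ℝ) (Cs : V₂ →L[ℝ] Q) (Iop : V₁ →L[ℝ] W)
    (α M_a m_a M_C M_I M L γ κ m_b M_b : ℝ)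
    (hα : 0 < α)
    (hMa : M_a = contConst a)
    (hma : m_a = infSupConst a) (hma_pos : 0 < m_a)
    (hnd : ∀ v₁ : V₁, (∀ v₂ : V₂, a v₁ v₂ = 0) → v₁ = 0)
    (hMC : M_C = ‖Cs‖) (hMI : M_I = ‖Iop‖)
    (hM : M = max M_I M_C)
    (hL : L = M / Real.sqrt α)
    (hγ : γ = (M / m_a) * (1 + 2 * M / Real.sqrt α))
    (hκ : κ = ((1 + 2 * L) / (1 + L)) * (1 + γ))
    (hmb : m_b = sInf {r : ℝ | ∃ φ : V₁ × V₂, φ ≠ 0 ∧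
      r = sSup {s : ℝ | ∃ v : V₁ × V₂, v ≠ 0 ∧
        s = bV a Cs Iop α v φ / (nV v * nAlpha Cs Iop M_a M α φ)}})
    (hMb : M_b = sSup {s : ℝ | ∃ v φ : V₁ × V₂, v ≠ 0 ∧ φ ≠ 0 ∧
      s = |bV a Cs Iop α v φ| / (nV v * nAlpha Cs Iop M_a M α φ)}) :
    (∀ v φ : V₁ × V₂, |bV a Cs Iop α v φ| ≤ nV v * nAlpha Cs Iop M_a M α φ) ∧
    (∀ φ : V₁ × V₂, ∃ v : V₁ × V₂,
      nV v ≤ (1 + γ) * nV φ ∧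
      ((1 + L) / (1 + 2 * L)) * (m_a / M_a) *
        (nAlpha Cs Iop M_a M α φ * nV φ) ≤ bV a Cs Iop α v φ ∧
      (1 / κ) * (m_a / M_a) *
        (nV v * nAlpha Cs Iop M_a M α φ) ≤ bV a Cs Iop α v φ) ∧
    (0 < (1 / κ) * (m_a / M_a) ∧ (1 / κ) * (m_a / M_a) ≤ m_b ∧ m_b ≤ M_b ∧ M_b ≤ 1) := by
  subst hMa hma
  have hI : ‖Iop‖ ≤ M := by rw [hM, hMI]; exact le_max_left _ _
  have hC : ‖Cs‖ ≤ M := by rw [hM, hMC]; exact le_max_right _ _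
  have hM0 : 0 ≤ M := (norm_nonneg _).trans hI
  have hL0 : 0 ≤ L := hL ▸ by positivity
  have hγL : γ = M / infSupConst a * (1 + 2 * L) := by rw [hγ, hL, mul_div_assoc]
  have hγ0 : 0 ≤ γ := hγL ▸ by positivity
  have hκ0 : 0 < κ := hκ ▸ by positivity
  have hMa : 0 < contConst a := hma_pos.trans_le (infSupConst_le_contConst a hma_pos)
  have hN0 (φ : V₁ × V₂) : 0 ≤ nAlpha Cs Iop (contConst a) M α φ := by
    have := nV_nonneg φ
    have hs : 0 ≤ sV Cs Iop φ := Real.sqrt_nonneg _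
    rw [nAlpha]
    positivity
  have hN {φ : V₁ × V₂} (hφ : φ ≠ 0) : 0 < nAlpha Cs Iop (contConst a) M α φ := by
    have := nV_pos hφ
    have hs : 0 ≤ sV Cs Iop φ := Real.sqrt_nonneg _
    rw [nAlpha]
    positivity
  have hcont := abs_bV_le a hma_pos hI hC α
  have hinf (φ : V₁ × V₂) : ∃ v : V₁ × V₂, nV v ≤ (1 + γ) * nV φ ∧
      ((1 + L) / (1 + 2 * L)) * (infSupConst a / contConst a) *
        (nAlpha Cs Iop (contConst a) M α φ * nV φ) ≤ bV a Cs Iop α v φ ∧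
      (1 / κ) * (infSupConst a / contConst a) *
        (nV v * nAlpha Cs Iop (contConst a) M α φ) ≤ bV a Cs Iop α v φ := by
    obtain ⟨v, hv, hb⟩ := exists_nV_le_le_bV a hma_pos hnd hI hC α hL hγL φ
    refine ⟨v, hv, hb, le_trans ?_ hb⟩
    have := hN0 φ
    calc _ ≤ 1 / κ * (infSupConst a / contConst a) *
          ((1 + γ) * nV φ * nAlpha Cs Iop (contConst a) M α φ) := by gcongr
      _ = _ := by
          rw [hκ]
          field_simp
  have hk0 : 0 < 1 / κ * (infSupConst a / contConst a) := by positivity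
  have habs {v φ : V₁ × V₂} (hv : v ≠ 0) (hφ : φ ≠ 0) :
      |bV a Cs Iop α v φ| / (nV v * nAlpha Cs Iop (contConst a) M α φ) ≤ 1 :=
    (div_le_one (mul_pos (nV_pos hv) (hN hφ))).2 (hcont v φ)
  have hle_abs {v φ : V₁ × V₂} (hv : v ≠ 0) (hφ : φ ≠ 0) :
      bV a Cs Iop α v φ / (nV v * nAlpha Cs Iop (contConst a) M α φ) ≤
        |bV a Cs Iop α v φ| / (nV v * nAlpha Cs Iop (contConst a) M α φ) :=
    div_le_div_of_nonneg_right (le_abs_self _) (mul_pos (nV_pos hv) (hN hφ)).le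
  have hsup {φ : V₁ × V₂} (hφ : φ ≠ 0) : 1 / κ * (infSupConst a / contConst a) ≤
      sSup {s : ℝ | ∃ v : V₁ × V₂, v ≠ 0 ∧
        s = bV a Cs Iop α v φ / (nV v * nAlpha Cs Iop (contConst a) M α φ)} := by
    obtain ⟨v, -, hpos, hb⟩ := hinf φ
    have hv : v ≠ 0 := by
      rintro rfl
      have h₁ : 0 < (1 + L) / (1 + 2 * L) * (infSupConst a / contConst a) *
          (nAlpha Cs Iop (contConst a) M α φ * nV φ) := by
        have := hN hφ
        have := nV_pos hφ
        positivity
      simp [bV, aV] at hpos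
      linarith
    refine ((le_div_iff₀ (mul_pos (nV_pos hv) (hN hφ))).2 hb).trans
      (le_csSup ⟨1, ?_⟩ ⟨v, hv, rfl⟩)
    rintro _ ⟨u, hu, rfl⟩
    exact (hle_abs hu hφ).trans (habs hu hφ)
  obtain ⟨φ₀, hφ₀⟩ := exists_ne (0 : V₁ × V₂)
  refine ⟨hcont, hinf, hk0, ?_, ?_, ?_⟩
  · rw [hmb]
    refine le_csInf ⟨_, φ₀, hφ₀, rfl⟩ ?_
    rintro _ ⟨φ, hφ, rfl⟩
    exact hsup hφ
  · rw [hmb, hMb]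
    refine csInf_le_of_le ⟨1 / κ * (infSupConst a / contConst a), ?_⟩ ⟨φ₀, hφ₀, rfl⟩
      (csSup_le ⟨_, φ₀, hφ₀, rfl⟩ ?_)
    · rintro _ ⟨φ, hφ, rfl⟩
      exact hsup hφ
    · rintro _ ⟨v, hv, rfl⟩
      refine (hle_abs hv hφ₀).trans (le_csSup ⟨1, ?_⟩ ⟨v, φ₀, hv, hφ₀, rfl⟩)
      rintro _ ⟨u, φ, hu, hφ, rfl⟩
      exact habs hu hφ
  · rw [hMb]
    refine csSup_le ⟨_, φ₀, φ₀, hφ₀, hφ₀, rfl⟩ ?_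
    rintro _ ⟨v, φ, hv, hφ, rfl⟩
    exact habs hv hφ
end

section
/- For every u_d ∈ W there exists a unique x_h = (u_h, z_h) ∈ V_h such that b(x_h, φ_h) = −α^{−1/2}·⟨u_d, Iφ_{h,1}⟩_W for all φ_h = (φ_{h,1}, φ_{h,2}) ∈ V_h (unique solvability of the discrete reduced optimality system on any pair of finite-dimensional subspaces on which a is nondegenerate). -/
open scoped RealInnerProductSpace
open Filter Topology

/-- A bilinear form on a finite-dimensional space with trivial left kernel represents every
linear functional uniquely. -/
theorem LinearMap.existsUnique_apply_eq_of_ker_eq_bot {K E : Type*} [Field K] [AddCommGroup E]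
    [Module K E] [FiniteDimensional K E] (B : E →ₗ[K] Module.Dual K E)
    (hB : LinearMap.ker B = ⊥) (f : Module.Dual K E) : ∃! x : E, ∀ y : E, B x y = f y := by
  have hinj : Function.Injective B := LinearMap.ker_eq_bot.mp hB
  have hsurj : Function.Surjective B :=
    (LinearMap.injective_iff_surjective_of_finrank_eq_finrank
      Subspace.dual_finrank_eq.symm).mp hinj
  obtain ⟨x, hx⟩ := hsurj f
  refine ⟨x, fun y => by rw [hx], fun x' hx' => hinj ?_⟩
  rw [hx]
  exact LinearMap.ext hx'

section ReducedForm

variable {V₁ V₂ Q W : Type*}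
  [NormedAddCommGroup V₁] [InnerProductSpace ℝ V₁]
  [NormedAddCommGroup V₂] [InnerProductSpace ℝ V₂]
  [NormedAddCommGroup Q] [InnerProductSpace ℝ Q]
  [NormedAddCommGroup W] [InnerProductSpace ℝ W]

/-- The form `bV` restricted to a product of subspaces, as a bilinear map. -/
noncomputable def bVRestrict (a : V₁ →L[ℝ] V₂ →L[ℝ] ℝ) (Cs : V₂ →L[ℝ] Q) (Iop : V₁ →L[ℝ] W) (α : ℝ)
    (Vh1 : Submodule ℝ V₁) (Vh2 : Submodule ℝ V₂) :
    (Vh1 × Vh2) →ₗ[ℝ] Module.Dual ℝ (Vh1 × Vh2) :=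
  LinearMap.mk₂ ℝ (fun x φ => bV a Cs Iop α ((x.1 : V₁), (x.2 : V₂)) ((φ.1 : V₁), (φ.2 : V₂)))
    (fun x y φ => by simp [bV, aV, inner_add_left]; ring)
    (fun c x φ => by simp [bV, aV, real_inner_smul_left]; ring)
    (fun x φ ψ => by simp [bV, aV, inner_add_right]; ring)
    (fun c x φ => by simp [bV, aV, real_inner_smul_right]; ring)

/-- Testing with `(v₁, -v₂)` cancels the coupling form and leaves the seminorm. -/
theorem bV_apply_neg_snd (a : V₁ →L[ℝ] V₂ →L[ℝ] ℝ) (Cs : V₂ →L[ℝ] Q) (Iop : V₁ →L[ℝ] W)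
    (α : ℝ) (v : V₁ × V₂) :
    bV a Cs Iop α v (v.1, -v.2) = -((Real.sqrt α)⁻¹ * (‖Iop v.1‖ ^ 2 + ‖Cs v.2‖ ^ 2)) := by
  simp [bV, aV, inner_neg_right]
  ring

theorem ker_bVRestrict_eq_bot (a : V₁ →L[ℝ] V₂ →L[ℝ] ℝ) (Cs : V₂ →L[ℝ] Q)
    (Iop : V₁ →L[ℝ] W) {α : ℝ} (hα : 0 < α) (Vh1 : Submodule ℝ V₁) (Vh2 : Submodule ℝ V₂)
    (hndh1 : ∀ v₁ ∈ Vh1, (∀ φ₂ ∈ Vh2, a v₁ φ₂ = 0) → v₁ = 0)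
    (hndh2 : ∀ v₂ ∈ Vh2, (∀ φ₁ ∈ Vh1, a φ₁ v₂ = 0) → v₂ = 0) :
    LinearMap.ker (bVRestrict a Cs Iop α Vh1 Vh2) = ⊥ := by
  refine LinearMap.ker_eq_bot'.mpr fun ⟨⟨u, hu⟩, ⟨z, hz⟩⟩ hx => ?_
  have hb : ∀ φ₁ ∈ Vh1, ∀ φ₂ ∈ Vh2, bV a Cs Iop α (u, z) (φ₁, φ₂) = 0 := fun φ₁ h₁ φ₂ h₂ =>
    LinearMap.congr_fun hx (⟨φ₁, h₁⟩, ⟨φ₂, h₂⟩)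
  have hs : 0 < (Real.sqrt α)⁻¹ := inv_pos.mpr (Real.sqrt_pos.mpr hα)
  have hsum : ‖Iop u‖ ^ 2 + ‖Cs z‖ ^ 2 = 0 := by
    have h := hb u hu (-z) (Vh2.neg_mem hz)
    rw [bV_apply_neg_snd a Cs Iop α (u, z), neg_eq_zero] at h
    exact (mul_eq_zero.mp h).resolve_left hs.ne'
  have hI : Iop u = 0 := by
    rw [← norm_eq_zero, ← sq_eq_zero_iff]
    linarith [sq_nonneg ‖Iop u‖, sq_nonneg ‖Cs z‖]
  have hC : Cs z = 0 := by
    rw [← norm_eq_zero, ← sq_eq_zero_iff]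
    linarith [sq_nonneg ‖Iop u‖, sq_nonneg ‖Cs z‖]
  have hu0 : u = 0 := hndh1 u hu fun φ₂ h₂ => by
    simpa [bV, aV, hI, hC] using hb 0 Vh1.zero_mem φ₂ h₂
  have hz0 : z = 0 := hndh2 z hz fun φ₁ h₁ => by
    simpa [bV, aV, hI, hC] using hb φ₁ h₁ 0 Vh2.zero_mem
  subst hu0 hz0
  rfl

end ReducedForm

/-- Lemma 3.1, discrete well-posedness: on any pair of
finite-dimensional subspaces on which `a` is nondegenerate, the discrete reduced
optimality system has a unique solution. -/
theorem stmt3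
    {V₁ V₂ Q W : Type*}
    [NormedAddCommGroup V₁] [InnerProductSpace ℝ V₁] [CompleteSpace V₁] [Nontrivial V₁]
    [NormedAddCommGroup V₂] [InnerProductSpace ℝ V₂] [CompleteSpace V₂] [Nontrivial V₂]
    [NormedAddCommGroup Q] [InnerProductSpace ℝ Q] [CompleteSpace Q]
    [NormedAddCommGroup W] [InnerProductSpace ℝ W] [CompleteSpace W]
    (a : V₁ →L[ℝ] V₂ →L[ℝ] ℝ) (Cs : V₂ →L[ℝ] Q) (Iop : V₁ →L[ℝ] W)
    (α m_a : ℝ) (hα : 0 < α)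
    (hma : m_a = infSupConst a) (hma_pos : 0 < m_a)
    (hnd : ∀ v₁ : V₁, (∀ v₂ : V₂, a v₁ v₂ = 0) → v₁ = 0)
    (Vh1 : Submodule ℝ V₁) (Vh2 : Submodule ℝ V₂)
    [FiniteDimensional ℝ Vh1] [FiniteDimensional ℝ Vh2]
    (hndh1 : ∀ v₁ ∈ Vh1, (∀ φ₂ ∈ Vh2, a v₁ φ₂ = 0) → v₁ = 0)
    (hndh2 : ∀ v₂ ∈ Vh2, (∀ φ₁ ∈ Vh1, a φ₁ v₂ = 0) → v₂ = 0) :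
    ∀ u_d : W, ∃! xh : V₁ × V₂, (xh.1 ∈ Vh1 ∧ xh.2 ∈ Vh2) ∧
      ∀ φh : V₁ × V₂, φh.1 ∈ Vh1 → φh.2 ∈ Vh2 →
        bV a Cs Iop α xh φh = -(Real.sqrt α)⁻¹ * ⟪u_d, Iop φh.1⟫ := by
  intro u_d
  let f : Module.Dual ℝ (Vh1 × Vh2) :=
    (-(Real.sqrt α)⁻¹) •
      ((innerSL ℝ u_d).comp Iop : V₁ →ₗ[ℝ] ℝ) ∘ₗ Vh1.subtype ∘ₗ LinearMap.fst ℝ Vh1 Vh2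
  obtain ⟨x, hx, huniq⟩ := LinearMap.existsUnique_apply_eq_of_ker_eq_bot
    (bVRestrict a Cs Iop α Vh1 Vh2)
    (ker_bVRestrict_eq_bot a Cs Iop hα Vh1 Vh2 hndh1 hndh2) f
  refine ⟨(x.1, x.2), ⟨⟨x.1.2, x.2.2⟩, fun φ h₁ h₂ => hx (⟨φ.1, h₁⟩, ⟨φ.2, h₂⟩)⟩, ?_⟩
  rintro ⟨u, z⟩ ⟨⟨hu, hz⟩, h⟩
  have hxy := huniq (⟨u, hu⟩, ⟨z, hz⟩) fun φ => h (φ.1, φ.2) φ.1.2 φ.2.2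
  rw [← hxy]
end

section
/- Assume I : V₁ → W and C* : V₂ → Q are compact operators, that the family of discretizations is uniformly stable (μ_h ≤ μ̄ for all h > 0) and approximating (for every v ∈ V, inf_{v_h ∈ V_h}‖v − v_h‖ → 0 as h → 0). Then the generalized Ritz projections converge uniformly in the seminorm: sup{|v − R_h v| : v ∈ V, ‖v‖ = 1} → 0 as h → 0. -/
open scoped RealInnerProductSpace
open Filter Topology

noncomputable section Setup

variable {V₁ V₂ Q W : Type*}
  [NormedAddCommGroup V₁] [InnerProductSpace ℝ V₁]
  [NormedAddCommGroup V₂] [InnerProductSpace ℝ V₂]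
  [NormedAddCommGroup Q] [InnerProductSpace ℝ Q]
  [NormedAddCommGroup W] [InnerProductSpace ℝ W]

/-- Discrete inf-sup constant of `a` on `V_{h,1} × V_{h,2}`. -/
def discInfSup (a : V₁ →L[ℝ] V₂ →L[ℝ] ℝ) (Vh1 : Submodule ℝ V₁)
    (Vh2 : Submodule ℝ V₂) : ℝ :=
  sInf {r : ℝ | ∃ v₁ ∈ Vh1, ‖v₁‖ = 1 ∧
    r = sSup {s : ℝ | ∃ φ₂ ∈ Vh2, ‖φ₂‖ = 1 ∧ s = a v₁ φ₂}}

/-- Best approximation error `inf_{v_h ∈ V_h} ‖x - v_h‖` in the product norm. -/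
def bestErr (Vh1 : Submodule ℝ V₁) (Vh2 : Submodule ℝ V₂) (x : V₁ × V₂) : ℝ :=
  sInf {r : ℝ | ∃ vh : V₁ × V₂, vh.1 ∈ Vh1 ∧ vh.2 ∈ Vh2 ∧ r = nV (x - vh)}

/-- The quasi-best-approximation constant `ν_h` of the Galerkin discretization of `b`:
`sup` over nonzero discrete test functions of the ratio of the continuous sup to the
discrete sup. -/
def nuConst (a : V₁ →L[ℝ] V₂ →L[ℝ] ℝ) (Cs : V₂ →L[ℝ] Q) (Iop : V₁ →L[ℝ] W) (α : ℝ)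
    (Vh1 : Submodule ℝ V₁) (Vh2 : Submodule ℝ V₂) : ℝ :=
  sSup {r : ℝ | ∃ φh : V₁ × V₂, φh.1 ∈ Vh1 ∧ φh.2 ∈ Vh2 ∧ φh ≠ 0 ∧
    r = sSup {s : ℝ | ∃ v : V₁ × V₂, nV v = 1 ∧ s = bV a Cs Iop α v φh} /
        sSup {s : ℝ | ∃ vh : V₁ × V₂, vh.1 ∈ Vh1 ∧ vh.2 ∈ Vh2 ∧ nV vh = 1 ∧
          s = bV a Cs Iop α vh φh}}

/-- The nonlinear form `c_{K,α}` associated with the control constraint set `K`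
(through its metric projection `PK`). -/
def cK (Cs : V₂ →L[ℝ] Q) (Iop : V₁ →L[ℝ] W) (PK : Q → Q) (α : ℝ) (v φ : V₁ × V₂) : ℝ :=
  -⟪PK ((-(Real.sqrt α)⁻¹) • (Cs v.2)), Cs φ.2⟫ - (Real.sqrt α)⁻¹ * ⟪Iop v.1, Iop φ.1⟫

/-- The nonlinear form `b_K = a + c_{K,α}`. -/
def bK (a : V₁ →L[ℝ] V₂ →L[ℝ] ℝ) (Cs : V₂ →L[ℝ] Q) (Iop : V₁ →L[ℝ] W) (PK : Q → Q)
    (α : ℝ) (v φ : V₁ × V₂) : ℝ :=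
  aV a v φ + cK Cs Iop PK α v φ

/-- The pseudometric `δ_{K,α}`. -/
def deltaK (Cs : V₂ →L[ℝ] Q) (Iop : V₁ →L[ℝ] W) (PK : Q → Q) (α : ℝ)
    (v w : V₁ × V₂) : ℝ :=
  Real.sqrt (α * ‖PK ((-(Real.sqrt α)⁻¹) • (Cs v.2)) -
      PK ((-(Real.sqrt α)⁻¹) • (Cs w.2))‖ ^ 2 + ‖Iop (v.1 - w.1)‖ ^ 2)

end Setup

/-- Solvability of the variational problem `B x · = ⟪f, ·⟫` for a bilinear form that is bounded
below in its first argument and nondegenerate in its second. -/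
theorem exists_forall_eq_inner_of_bound {X Y : Type*}
    [NormedAddCommGroup X] [InnerProductSpace ℝ X] [CompleteSpace X]
    [NormedAddCommGroup Y] [InnerProductSpace ℝ Y] [CompleteSpace Y]
    (B : X →L[ℝ] Y →L[ℝ] ℝ) {C : ℝ} (hC : 0 ≤ C) (hB : ∀ x, ‖x‖ ≤ C * ‖B x‖)
    (hnd : ∀ y, (∀ x, B x y = 0) → y = 0) (f : Y) :
    ∃ x, ∀ y, B x y = ⟪f, y⟫ := by
  let L : X →L[ℝ] Y := LinearMap.mkContinuous
    { toFun := fun x => (InnerProductSpace.toDual ℝ Y).symm (B x)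
      map_add' := fun x y => by simp
      map_smul' := fun c x => by simp } ‖B‖ (fun x => by simpa using B.le_opNorm x)
  have hL : ∀ x y, ⟪L x, y⟫ = B x y := fun x y =>
    InnerProductSpace.toDual_symm_apply (𝕜 := ℝ) (x := y) (y := B x)
  have hanti : AntilipschitzWith C.toNNReal L := by
    refine L.antilipschitz_of_bound fun x => ?_
    rw [Real.coe_toNNReal _ hC]
    simpa [L] using hB x
  have hclosed : IsClosed (L.range : Set Y) := by
    rw [LinearMap.coe_range]
    exact hanti.isClosed_range L.uniformContinuous
  have : CompleteSpace L.range := hclosed.completeSpace_coe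
  have htop : L.range = ⊤ := by
    rw [← Submodule.orthogonal_eq_bot_iff, Submodule.eq_bot_iff]
    intro y hy
    refine hnd y fun x => ?_
    rw [← hL]
    exact (Submodule.mem_orthogonal _ _).1 hy _ ⟨x, rfl⟩
  obtain ⟨x, hx⟩ : f ∈ L.range := htop ▸ Submodule.mem_top
  exact ⟨x, fun y => by rw [← hL, ← hx]; rfl⟩

/-- A lower bound in the first argument transfers, with the same constant, to the second. -/
theorem norm_le_mul_norm_flip_of_bound {X Y : Type*}
    [NormedAddCommGroup X] [InnerProductSpace ℝ X] [CompleteSpace X]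
    [NormedAddCommGroup Y] [InnerProductSpace ℝ Y] [CompleteSpace Y]
    (B : X →L[ℝ] Y →L[ℝ] ℝ) {C : ℝ} (hC : 0 ≤ C) (hB : ∀ x, ‖x‖ ≤ C * ‖B x‖)
    (hnd : ∀ y, (∀ x, B x y = 0) → y = 0) (y : Y) :
    ‖y‖ ≤ C * ‖B.flip y‖ := by
  obtain ⟨x, hx⟩ := exists_forall_eq_inner_of_bound B hC hB hnd y
  have hBx : ‖B x‖ ≤ ‖y‖ := ContinuousLinearMap.opNorm_le_bound _ (norm_nonneg _) fun z => by
    rw [hx]; exact norm_inner_le_norm y z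
  have hxy : ‖x‖ ≤ C * ‖y‖ := (hB x).trans (by gcongr)
  have h1 : ‖y‖ * ‖y‖ ≤ ‖B.flip y‖ * (C * ‖y‖) := by
    rw [← real_inner_self_eq_norm_mul_norm, ← hx y]
    calc B x y ≤ ‖B.flip y x‖ := le_abs_self _
      _ ≤ ‖B.flip y‖ * ‖x‖ := (B.flip y).le_opNorm x
      _ ≤ _ := by gcongr
  rcases (norm_nonneg y).eq_or_lt with h0 | h0
  · rw [← h0]; positivity
  · exact le_of_mul_le_mul_right (by linarith) h0

/-- A compact operator composed with uniformly bounded error operators, whose transposes with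
respect to `a` tend to zero pointwise, tends to zero uniformly on the unit ball. -/
theorem IsCompactOperator.eventually_norm_apply_le {X Y Z ι : Type*} {l : Filter ι}
    [NormedAddCommGroup X] [InnerProductSpace ℝ X] [CompleteSpace X]
    [NormedAddCommGroup Y] [InnerProductSpace ℝ Y]
    [NormedAddCommGroup Z] [InnerProductSpace ℝ Z] [CompleteSpace Z]
    (a : X →L[ℝ] Y →L[ℝ] ℝ) (ha : ∀ f, ∃ z, ∀ x, a x z = ⟪f, x⟫)
    {T : X →L[ℝ] Z} (hT : IsCompactOperator T)
    {E : ι → X → X} {F : ι → Y → Y} {K : ℝ}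
    (hE : ∀ᶠ h in l, ∀ x, ‖E h x‖ ≤ K * ‖x‖)
    (hF : ∀ y, Tendsto (fun h => ‖F h y‖) l (𝓝 0))
    (hEF : ∀ᶠ h in l, ∀ x y, a (E h x) y = a x (F h y))
    {ε : ℝ} (hε : 0 < ε) :
    ∀ᶠ h in l, ∀ x, ‖x‖ ≤ 1 → ‖T (E h x)‖ ≤ ε := by
  have htb : TotallyBounded (T '' Metric.closedBall 0 |K|) :=
    (hT.isCompact_closure_image_closedBall |K|).totallyBounded.subset subset_closure
  obtain ⟨t, htf, ht⟩ := Metric.totallyBounded_iff.1 htb (ε / 2) (half_pos hε)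
  choose z hz using fun w => ha (T.adjoint w)
  have hsmall : ∀ᶠ h in l, ∀ w ∈ t, ‖a‖ * ‖F h (z w)‖ < ε ^ 2 / 2 := by
    refine (eventually_all_finite htf).2 fun w _ => ?_
    have := (hF (z w)).const_mul ‖a‖
    rw [mul_zero] at this
    exact this.eventually_lt_const (by positivity)
  filter_upwards [hE, hEF, hsmall] with h hE hEF hsmall x hx
  have hmem : T (E h x) ∈ T '' Metric.closedBall 0 |K| := by
    refine Set.mem_image_of_mem _ (mem_closedBall_zero_iff.2 ((hE x).trans ?_))
    calc K * ‖x‖ ≤ |K| * 1 := by gcongr; exact le_abs_self K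
      _ = |K| := mul_one _
  obtain ⟨w, hw, hd⟩ := Set.mem_iUnion₂.1 (ht hmem)
  rw [mem_ball_iff_norm] at hd
  set u := T (E h x) with hu
  have h1 : ⟪u, u - w⟫ ≤ ‖u‖ * (ε / 2) := (real_inner_le_norm _ _).trans (by gcongr)
  have h2 : ⟪u, w⟫ ≤ ε ^ 2 / 2 := by
    have : ⟪u, w⟫ = a x (F h (z w)) := by
      rw [← hEF, hz, ContinuousLinearMap.adjoint_inner_left, real_inner_comm]
    rw [this]
    calc a x (F h (z w)) ≤ ‖a x (F h (z w))‖ := le_abs_self _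
      _ ≤ ‖a‖ * ‖x‖ * ‖F h (z w)‖ := a.le_opNorm₂ _ _
      _ ≤ ‖a‖ * 1 * ‖F h (z w)‖ := by gcongr
      _ ≤ ε ^ 2 / 2 := by rw [mul_one]; exact (hsmall w hw).le
  have h3 : ‖u‖ * ‖u‖ = ⟪u, u - w⟫ + ⟪u, w⟫ := by
    rw [← inner_add_right, sub_add_cancel, real_inner_self_eq_norm_mul_norm]
  by_contra! hlt
  nlinarith

/-- The discrete inf-sup constant bounds the restricted form from below. -/
theorem discInfSup_mul_norm_le {V₁ V₂ : Type*}
    [NormedAddCommGroup V₁] [InnerProductSpace ℝ V₁]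
    [NormedAddCommGroup V₂] [InnerProductSpace ℝ V₂]
    (a : V₁ →L[ℝ] V₂ →L[ℝ] ℝ) (S₁ : Submodule ℝ V₁) (S₂ : Submodule ℝ V₂) (x : S₁) :
    discInfSup a S₁ S₂ * ‖x‖ ≤ ‖a.bilinearComp S₁.subtypeL S₂.subtypeL x‖ := by
  set B := a.bilinearComp S₁.subtypeL S₂.subtypeL with hB
  rcases eq_or_ne x 0 with rfl | hx
  · simp
  have hx0 : 0 < ‖x‖ := norm_pos_iff.2 hx
  have hbdd : BddBelow {r : ℝ | ∃ v₁ ∈ S₁, ‖v₁‖ = 1 ∧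
      r = sSup {s : ℝ | ∃ φ₂ ∈ S₂, ‖φ₂‖ = 1 ∧ s = a v₁ φ₂}} := by
    refine ⟨0, ?_⟩
    rintro r ⟨v, -, -, rfl⟩
    rcases Set.eq_empty_or_nonempty {s : ℝ | ∃ φ₂ ∈ S₂, ‖φ₂‖ = 1 ∧ s = a v φ₂} with he | he
    · simp [he]
    · obtain ⟨s, φ, hφ, hφ1, rfl⟩ := he
      rcases le_total 0 (a v φ) with h0 | h0
      · exact Real.sSup_nonneg' ⟨_, ⟨φ, hφ, hφ1, rfl⟩, h0⟩
      · exact Real.sSup_nonneg' ⟨_, ⟨-φ, S₂.neg_mem hφ, by simpa using hφ1, rfl⟩, by simpa using h0⟩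
  have hle : discInfSup a S₁ S₂ ≤ ‖x‖⁻¹ * ‖B x‖ := by
    refine (csInf_le hbdd ⟨(‖x‖⁻¹ • x : S₁), Subtype.prop _, ?_, rfl⟩).trans ?_
    · rw [← Submodule.coe_norm, norm_smul, norm_inv, norm_norm, inv_mul_cancel₀ hx0.ne']
    · refine Real.sSup_le ?_ (by positivity)
      rintro s ⟨φ, hφ, hφ1, rfl⟩
      have h1 : B x ⟨φ, hφ⟩ ≤ ‖B x‖ := by
        refine (le_abs_self _).trans (((B x).le_opNorm _).trans ?_)
        simp [hφ1]
      have h2 : a ((‖x‖⁻¹ • x : S₁) : V₁) φ = ‖x‖⁻¹ * B x ⟨φ, hφ⟩ := by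
        simp [hB]
      rw [h2]
      gcongr
  calc _ ≤ ‖x‖⁻¹ * ‖B x‖ * ‖x‖ := by gcongr
    _ = ‖B x‖ := by field_simp

/-- Quasi-optimality of the Ritz projection onto a subspace on which the form is bounded below. -/
theorem norm_sub_le_of_galerkin_orthogonality {X Y : Type*}
    [NormedAddCommGroup X] [InnerProductSpace ℝ X]
    [NormedAddCommGroup Y] [InnerProductSpace ℝ Y]
    (a : X →L[ℝ] Y →L[ℝ] ℝ) {S : Submodule ℝ X} {S' : Submodule ℝ Y} {C : ℝ} (hC : 0 ≤ C)
    (hS : ∀ x : S, ‖x‖ ≤ C * ‖a.bilinearComp S.subtypeL S'.subtypeL x‖)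
    {x r s : X} (hr : r ∈ S) (hs : s ∈ S) (horth : ∀ y ∈ S', a r y = a x y) :
    ‖x - r‖ ≤ (1 + C * ‖a‖) * ‖x - s‖ := by
  have h1 : ‖a.bilinearComp S.subtypeL S'.subtypeL (⟨r, hr⟩ - ⟨s, hs⟩)‖ ≤ ‖a‖ * ‖x - s‖ := by
    refine ContinuousLinearMap.opNorm_le_bound _ (by positivity) fun y => ?_
    have : a.bilinearComp S.subtypeL S'.subtypeL (⟨r, hr⟩ - ⟨s, hs⟩) y = a (x - s) y := by
      simp [horth y y.2]
    rw [this]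
    exact a.le_opNorm₂ _ _
  have h2 : ‖r - s‖ ≤ C * (‖a‖ * ‖x - s‖) :=
    (hS (⟨r, hr⟩ - ⟨s, hs⟩)).trans (by gcongr)
  have h3 : ‖x - r‖ ≤ ‖x - s‖ + ‖r - s‖ := by
    rw [norm_sub_rev r s]; exact norm_sub_le_norm_sub_add_norm_sub x s r
  linarith

theorem norm_fst_le_nV {V₁ V₂ : Type*}
    [NormedAddCommGroup V₁] [NormedAddCommGroup V₂] (v : V₁ × V₂) : ‖v.1‖ ≤ nV v :=
  Real.le_sqrt_of_sq_le (by nlinarith [sq_nonneg ‖v.2‖])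

theorem norm_snd_le_nV {V₁ V₂ : Type*}
    [NormedAddCommGroup V₁] [NormedAddCommGroup V₂] (v : V₁ × V₂) : ‖v.2‖ ≤ nV v :=
  Real.le_sqrt_of_sq_le (by nlinarith [sq_nonneg ‖v.1‖])

theorem le_mul_bestErr {V₁ V₂ : Type*}
    [NormedAddCommGroup V₁] [InnerProductSpace ℝ V₁]
    [NormedAddCommGroup V₂] [InnerProductSpace ℝ V₂]
    {S₁ : Submodule ℝ V₁} {S₂ : Submodule ℝ V₂} {v : V₁ × V₂} {b K : ℝ} (hK : 0 < K)
    (h : ∀ s₁ ∈ S₁, ∀ s₂ ∈ S₂, b ≤ K * nV (v - (s₁, s₂))) :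
    b ≤ K * bestErr S₁ S₂ v := by
  rw [← div_le_iff₀' hK]
  refine le_csInf ⟨_, 0, S₁.zero_mem, S₂.zero_mem, rfl⟩ ?_
  rintro r ⟨s, h₁, h₂, rfl⟩
  rw [div_le_iff₀' hK]
  exact h s.1 h₁ s.2 h₂

/-- uniform convergence of the Ritz projections in the seminorm,
key step of Lemma 3.6: under compactness of `I` and `C*`, uniform stability, and
approximability, `sup_{‖v‖=1} |v − R_h v| → 0` as `h → 0`. -/
theorem stmt7
    {V₁ V₂ Q W : Type*}
    [NormedAddCommGroup V₁] [InnerProductSpace ℝ V₁] [CompleteSpace V₁] [Nontrivial V₁]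
    [NormedAddCommGroup V₂] [InnerProductSpace ℝ V₂] [CompleteSpace V₂] [Nontrivial V₂]
    [NormedAddCommGroup Q] [InnerProductSpace ℝ Q] [CompleteSpace Q]
    [NormedAddCommGroup W] [InnerProductSpace ℝ W] [CompleteSpace W]
    (a : V₁ →L[ℝ] V₂ →L[ℝ] ℝ) (Cs : V₂ →L[ℝ] Q) (Iop : V₁ →L[ℝ] W)
    (m_a : ℝ)
    (hma : m_a = infSupConst a) (hma_pos : 0 < m_a)
    (hnd : ∀ v₁ : V₁, (∀ v₂ : V₂, a v₁ v₂ = 0) → v₁ = 0)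
    (hadj : ∀ v₂ : V₂, ‖v₂‖ = sSup {r : ℝ | ∃ φ₁ : V₁, ‖φ₁‖ = 1 ∧ r = a φ₁ v₂})
    -- compactness of the observation and control-action operators
    (hIc : IsCompactOperator (⇑Iop)) (hCc : IsCompactOperator (⇑Cs))
    -- family of discretizations
    (Vh1 : ℝ → Submodule ℝ V₁) (Vh2 : ℝ → Submodule ℝ V₂)
    (hfd1 : ∀ h > (0 : ℝ), FiniteDimensional ℝ (Vh1 h))
    (hfd2 : ∀ h > (0 : ℝ), FiniteDimensional ℝ (Vh2 h))
    (hndh1 : ∀ h > (0 : ℝ), ∀ v₁ ∈ Vh1 h, (∀ φ₂ ∈ Vh2 h, a v₁ φ₂ = 0) → v₁ = 0)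
    (hndh2 : ∀ h > (0 : ℝ), ∀ v₂ ∈ Vh2 h, (∀ φ₁ ∈ Vh1 h, a φ₁ v₂ = 0) → v₂ = 0)
    (μ : ℝ → ℝ) (μbar : ℝ)
    (hμ_pos : ∀ h > (0 : ℝ), 0 < μ h)
    (hμ : ∀ h > (0 : ℝ), 1 / μ h = discInfSup a (Vh1 h) (Vh2 h))
    -- uniform stability
    (hstab : ∀ h > (0 : ℝ), μ h ≤ μbar)
    -- approximability
    (happrox : ∀ v : V₁ × V₂,
      Tendsto (fun h => bestErr (Vh1 h) (Vh2 h) v) (𝓝[>] (0 : ℝ)) (𝓝 0))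
    -- the generalized Ritz projections
    (Rh : ℝ → (V₁ × V₂) → V₁ × V₂)
    (hRh_mem : ∀ h > (0 : ℝ), ∀ v : V₁ × V₂, (Rh h v).1 ∈ Vh1 h ∧ (Rh h v).2 ∈ Vh2 h)
    (hRh1 : ∀ h > (0 : ℝ), ∀ v : V₁ × V₂, ∀ φ₂ ∈ Vh2 h, a (Rh h v).1 φ₂ = a v.1 φ₂)
    (hRh2 : ∀ h > (0 : ℝ), ∀ v : V₁ × V₂, ∀ φ₁ ∈ Vh1 h, a φ₁ (Rh h v).2 = a φ₁ v.2) :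
    Tendsto (fun h => sSup {r : ℝ | ∃ v : V₁ × V₂, nV v = 1 ∧ r = sV Cs Iop (v - Rh h v)})
      (𝓝[>] (0 : ℝ)) (𝓝 0) := by
  have hμbar : 0 ≤ μbar := ((hμ_pos 1 one_pos).trans_le (hstab 1 one_pos)).le
  -- continuous stability in both arguments
  have hbd : ∀ v₂, ‖v₂‖ ≤ 1 * ‖a.flip v₂‖ := by
    intro v₂
    rw [hadj v₂, one_mul]
    refine Real.sSup_le ?_ (norm_nonneg _)
    rintro r ⟨φ, hφ, rfl⟩
    refine (le_abs_self _).trans (((a.flip v₂).le_opNorm φ).trans ?_)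
    rw [hφ, mul_one]
  have hsolve₁ : ∀ f : V₁, ∃ z, ∀ x, a x z = ⟪f, x⟫ :=
    exists_forall_eq_inner_of_bound a.flip zero_le_one hbd hnd
  have hsolve₂ : ∀ f : V₂, ∃ z, ∀ x, a.flip x z = ⟪f, x⟫ :=
    exists_forall_eq_inner_of_bound a zero_le_one
      (norm_le_mul_norm_flip_of_bound a.flip zero_le_one hbd hnd)
      (fun y hy => norm_le_zero_iff.1 <| (hbd y).trans <| by
        rw [one_mul, show a.flip y = 0 from ContinuousLinearMap.ext hy, norm_zero])
  -- discrete stability in both arguments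
  have hst₁ : ∀ h > (0 : ℝ), ∀ x : Vh1 h,
      ‖x‖ ≤ μbar * ‖a.bilinearComp (Vh1 h).subtypeL (Vh2 h).subtypeL x‖ := by
    intro h hh x
    have h1 := discInfSup_mul_norm_le a (Vh1 h) (Vh2 h) x
    rw [← hμ h hh, one_div, inv_mul_le_iff₀ (hμ_pos h hh)] at h1
    exact h1.trans (by gcongr; exact hstab h hh)
  have hst₂ : ∀ h > (0 : ℝ), ∀ y : Vh2 h,
      ‖y‖ ≤ μbar * ‖a.flip.bilinearComp (Vh2 h).subtypeL (Vh1 h).subtypeL y‖ := by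
    intro h hh
    have := hfd1 h hh
    have := hfd2 h hh
    have : CompleteSpace (Vh1 h) := FiniteDimensional.complete ℝ _
    have : CompleteSpace (Vh2 h) := FiniteDimensional.complete ℝ _
    exact norm_le_mul_norm_flip_of_bound _ hμbar (hst₁ h hh) fun y hy =>
      Subtype.ext (hndh2 h hh y y.2 fun φ hφ => hy ⟨φ, hφ⟩)
  set K := 1 + μbar * ‖a‖ with hK
  have hK0 : 0 < K := by positivity
  have hq₁ : ∀ h > (0 : ℝ), ∀ v : V₁ × V₂, ∀ s ∈ Vh1 h, ‖v.1 - (Rh h v).1‖ ≤ K * ‖v.1 - s‖ :=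
    fun h hh v s hs => norm_sub_le_of_galerkin_orthogonality a hμbar (hst₁ h hh)
      (hRh_mem h hh v).1 hs (hRh1 h hh v)
  have hq₂ : ∀ h > (0 : ℝ), ∀ v : V₁ × V₂, ∀ s ∈ Vh2 h, ‖v.2 - (Rh h v).2‖ ≤ K * ‖v.2 - s‖ := by
    intro h hh v s hs
    have := norm_sub_le_of_galerkin_orthogonality a.flip hμbar (hst₂ h hh)
      (hRh_mem h hh v).2 hs (hRh2 h hh v)
    rwa [ContinuousLinearMap.opNorm_flip] at this
  let E₁ : ℝ → V₁ → V₁ := fun h x => x - (Rh h (x, 0)).1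
  let E₂ : ℝ → V₂ → V₂ := fun h y => y - (Rh h (0, y)).2
  have hE₁ : ∀ h > (0 : ℝ), ∀ v, v.1 - (Rh h v).1 = E₁ h v.1 := by
    intro h hh v
    have := hndh1 h hh _ (sub_mem (hRh_mem h hh v).1 (hRh_mem h hh (v.1, 0)).1) fun φ hφ => by
      rw [map_sub, sub_apply, hRh1 h hh _ φ hφ, hRh1 h hh _ φ hφ, sub_self]
    simp only [E₁, sub_eq_zero.1 this]
  have hE₂ : ∀ h > (0 : ℝ), ∀ v, v.2 - (Rh h v).2 = E₂ h v.2 := by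
    intro h hh v
    have := hndh2 h hh _ (sub_mem (hRh_mem h hh v).2 (hRh_mem h hh (0, v.2)).2) fun φ hφ => by
      rw [map_sub, hRh2 h hh _ φ hφ, hRh2 h hh _ φ hφ, sub_self]
    simp only [E₂, sub_eq_zero.1 this]
  have hpos : ∀ᶠ h in 𝓝[>] (0 : ℝ), 0 < h := self_mem_nhdsWithin
  have hbE₁ : ∀ᶠ h in 𝓝[>] (0 : ℝ), ∀ x, ‖E₁ h x‖ ≤ K * ‖x‖ := by
    filter_upwards [hpos] with h hh x
    simpa using hq₁ h hh (x, 0) 0 (zero_mem _)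
  have hbE₂ : ∀ᶠ h in 𝓝[>] (0 : ℝ), ∀ y, ‖E₂ h y‖ ≤ K * ‖y‖ := by
    filter_upwards [hpos] with h hh y
    simpa using hq₂ h hh (0, y) 0 (zero_mem _)
  have hlim : ∀ v, Tendsto (fun h => K * bestErr (Vh1 h) (Vh2 h) v) (𝓝[>] 0) (𝓝 0) := fun v => by
    simpa using (happrox v).const_mul K
  have htE₁ : ∀ x, Tendsto (fun h => ‖E₁ h x‖) (𝓝[>] 0) (𝓝 0) := by
    intro x
    refine squeeze_zero' (Eventually.of_forall fun _ => norm_nonneg _) ?_ (hlim (x, 0))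
    filter_upwards [hpos] with h hh
    refine le_mul_bestErr hK0 fun s₁ h₁ s₂ _ => (hq₁ h hh (x, 0) s₁ h₁).trans ?_
    gcongr
    exact norm_fst_le_nV ((x, 0) - (s₁, s₂))
  have htE₂ : ∀ y, Tendsto (fun h => ‖E₂ h y‖) (𝓝[>] 0) (𝓝 0) := by
    intro y
    refine squeeze_zero' (Eventually.of_forall fun _ => norm_nonneg _) ?_ (hlim (0, y))
    filter_upwards [hpos] with h hh
    refine le_mul_bestErr hK0 fun s₁ _ s₂ h₂ => (hq₂ h hh (0, y) s₂ h₂).trans ?_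
    gcongr
    exact norm_snd_le_nV ((0, y) - (s₁, s₂))
  have hdual : ∀ᶠ h in 𝓝[>] (0 : ℝ), ∀ x y, a (E₁ h x) y = a x (E₂ h y) := by
    filter_upwards [hpos] with h hh x y
    have h1 := hRh1 h hh (x, 0) _ (hRh_mem h hh (0, y)).2
    have h2 := hRh2 h hh (0, y) _ (hRh_mem h hh (x, 0)).1
    simp only [E₁, E₂, map_sub, sub_apply]
    linarith
  rw [Metric.tendsto_nhds]
  intro ε hε
  filter_upwards [hpos,
    hIc.eventually_norm_apply_le a hsolve₁ hbE₁ htE₂ hdual (ε := ε / 2) (by positivity),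
    hCc.eventually_norm_apply_le a.flip hsolve₂ hbE₂ htE₁
      (hdual.mono fun h H y x => (H x y).symm) (ε := ε / 2) (by positivity)] with h hh h₁ h₂
  have hnn : 0 ≤ sSup {r : ℝ | ∃ v : V₁ × V₂, nV v = 1 ∧ r = sV Cs Iop (v - Rh h v)} := by
    refine Real.sSup_nonneg ?_
    rintro r ⟨v, -, rfl⟩
    exact Real.sqrt_nonneg _
  rw [Real.dist_0_eq_abs, abs_of_nonneg hnn]
  refine (Real.sSup_le ?_ (by positivity)).trans_lt (show 3 / 4 * ε < ε by linarith)
  rintro r ⟨v, hv, rfl⟩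
  have e₁ := h₁ v.1 (hv ▸ norm_fst_le_nV v)
  have e₂ := h₂ v.2 (hv ▸ norm_snd_le_nV v)
  rw [← hE₁ h hh] at e₁
  rw [← hE₂ h hh] at e₂
  refine Real.sqrt_le_iff.2 ⟨by positivity, ?_⟩
  rw [Prod.fst_sub, Prod.snd_sub]
  have s₁ := pow_le_pow_left₀ (norm_nonneg _) e₁ 2
  have s₂ := pow_le_pow_left₀ (norm_nonneg _) e₂ 2
  nlinarith [sq_nonneg ε]
end

section
/- Assume I : V₁ → W and C* : V₂ → Q are compact operators, uniform stability (μ_h ≤ μ̄ for all h > 0) and approximability (for every v ∈ V, inf_{v_h ∈ V_h}‖v − v_h‖ → 0 as h → 0). Then there exists ε : (0,∞) → [0,∞) with ε(h) → 0 as h → 0 such that |ν_h − μ_h| ≤ κ̄·μ_h·ε(h) for all h > 0, where κ̄ = ((1+2L)/(1+L))·(1 + M(1 + 2M/√α)·μ̄) with L = M/√α; i.e., ν_h = μ_h(1 + κ̄·o(1)) as h → 0. -/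
open scoped RealInnerProductSpace
open Filter Topology

section SupNorm

variable {H : Type*} [NormedAddCommGroup H] [InnerProductSpace ℝ H]

/-- The supremum of a linear functional over the unit sphere of a subspace is the norm of the
orthogonal projection of its Riesz representative. -/
theorem sSup_inner_eq_norm_starProjection (U : Submodule ℝ H) [U.HasOrthogonalProjection] (w : H) :
    sSup {s : ℝ | ∃ v ∈ U, ‖v‖ = 1 ∧ s = ⟪v, w⟫} = ‖U.starProjection w‖ := by
  have key : ∀ v ∈ U, ⟪v, w⟫ = ⟪v, U.starProjection w⟫ := fun v hv => by
    rw [← Submodule.inner_starProjection_left_eq_right,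
      Submodule.starProjection_eq_self_iff.2 hv]
  have hbd : ∀ s ∈ {s : ℝ | ∃ v ∈ U, ‖v‖ = 1 ∧ s = ⟪v, w⟫}, s ≤ ‖U.starProjection w‖ := by
    rintro s ⟨v, hv, hv1, rfl⟩
    rw [key v hv]
    simpa [hv1] using real_inner_le_norm v (U.starProjection w)
  refine le_antisymm (Real.sSup_le hbd (norm_nonneg _)) ?_
  by_cases h0 : U.starProjection w = 0
  · rw [h0, norm_zero]
    refine Real.sSup_nonneg ?_
    rintro s ⟨v, hv, -, rfl⟩
    rw [key v hv, h0, inner_zero_right]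
  · have hn : ‖U.starProjection w‖ ≠ 0 := norm_ne_zero_iff.2 h0
    have hm : U.starProjection w ∈ U := U.starProjection_apply_mem w
    refine le_csSup ⟨_, hbd⟩ ⟨‖U.starProjection w‖⁻¹ • U.starProjection w, U.smul_mem _ hm, ?_, ?_⟩
    · rw [norm_smul, norm_inv, norm_norm, inv_mul_cancel₀ hn]
    · rw [key _ (U.smul_mem _ hm), real_inner_smul_left, real_inner_self_eq_norm_sq]
      field_simp

end SupNorm

section CompactPerturbation

variable {H : Type*} [NormedAddCommGroup H] [NormedSpace ℝ H]

/-- Pointwise approximability upgrades to uniform approximability on the image of the unit ball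
under a compact operator. -/
theorem IsCompactOperator.eventually_uniform_approx {ι : Type*} {l : Filter ι} {K : H →L[ℝ] H}
    (hK : IsCompactOperator K) (U : ι → Submodule ℝ H)
    (hU : ∀ x : H, ∀ η > (0 : ℝ), ∀ᶠ i in l, ∃ u ∈ U i, ‖x - u‖ < η) {δ : ℝ} (hδ : 0 < δ) :
    ∀ᶠ i in l, ∀ x : H, ∃ u ∈ U i, ‖K x - u‖ ≤ δ * ‖x‖ := by
  have hc := (hK.isCompact_closure_image_closedBall (f := (K : H →ₗ[ℝ] H)) 1).totallyBounded
  obtain ⟨t, htf, ht⟩ := Metric.totallyBounded_iff.1 hc (δ / 2) (half_pos hδ)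
  filter_upwards [(Filter.eventually_all_finite htf).2 fun y _ => hU y (δ / 2) (half_pos hδ)]
    with i hi x
  rcases eq_or_ne x 0 with rfl | hx
  · exact ⟨0, (U i).zero_mem, by simp⟩
  have hn : 0 < ‖x‖ := norm_pos_iff.2 hx
  have hmem : K (‖x‖⁻¹ • x) ∈ closure ((K : H →ₗ[ℝ] H) '' Metric.closedBall 0 1) := by
    refine subset_closure ⟨‖x‖⁻¹ • x, ?_, rfl⟩
    simp [norm_smul, hn.ne']
  obtain ⟨y, hy, hxy⟩ := Set.mem_iUnion₂.1 (ht hmem)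
  obtain ⟨u, hu, hyu⟩ := hi y hy
  refine ⟨‖x‖ • u, (U i).smul_mem _ hu, ?_⟩
  have h1 : ‖K (‖x‖⁻¹ • x) - u‖ ≤ δ := by
    rw [Metric.mem_ball, dist_eq_norm] at hxy
    have := norm_sub_le_norm_sub_add_norm_sub (K (‖x‖⁻¹ • x)) y u
    linarith
  have h2 : K x - ‖x‖ • u = ‖x‖ • (K (‖x‖⁻¹ • x) - u) := by
    rw [smul_sub, map_smul, smul_smul, mul_inv_cancel₀ hn.ne', one_smul]
  rw [h2, norm_smul, norm_norm, mul_comm]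
  exact mul_le_mul_of_nonneg_right h1 hn.le

/-- Fredholm alternative for `1 + K`: injectivity gives surjectivity and a lower bound. -/
theorem IsCompactOperator.one_add_bijective_bound [CompleteSpace H] {K : H →L[ℝ] H}
    (hK : IsCompactOperator K) (hinj : ∀ x, x + K x = 0 → x = 0) :
    (∀ y, ∃ x, x + K x = y) ∧ ∃ ρ > (0 : ℝ), ∀ x, ‖x‖ ≤ ρ * ‖x + K x‖ := by
  have hne : ¬ Module.End.HasEigenvalue (K : Module.End ℝ H) (-1) := by
    intro h
    obtain ⟨x, hx⟩ := h.exists_hasEigenvector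
    refine hx.2 (hinj x ?_)
    have : K x = (-1 : ℝ) • x := hx.apply_eq_smul
    rw [this]; simp
  have hres := (hK.hasEigenvalue_or_mem_resolventSet (μ := (-1 : ℝ)) (by norm_num)).resolve_left hne
  rw [spectrum.mem_resolventSet_iff, ContinuousLinearMap.isUnit_iff_bijective] at hres
  have happ : ∀ x, (algebraMap ℝ (H →L[ℝ] H) (-1) - K) x = -(x + K x) := fun x => by
    simp [Algebra.algebraMap_eq_smul_one]; abel
  refine ⟨fun y => ?_, ?_⟩
  · obtain ⟨x, hx⟩ := hres.2 (-y)
    rw [happ] at hx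
    exact ⟨x, neg_injective hx⟩
  · obtain ⟨c, hc⟩ := hK.antilipschitz_of_not_hasEigenvalue (μ := (-1 : ℝ)) (by norm_num) hne
    refine ⟨c + 1, by positivity, fun x => ?_⟩
    have h1 := hc.le_mul_dist x 0
    have h2 : (K - (-1 : ℝ) • (1 : H →L[ℝ] H)) x = x + K x := by simp; abel
    rw [dist_zero_right, map_zero, dist_zero_right, h2] at h1
    nlinarith [norm_nonneg (x + K x)]

/-- Quasi-optimality constants of an isometry `J` and of its compact perturbation `J (1 + K)` on a
subspace `U` differ by little when `U` approximates the range of `K` well. -/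
theorem abs_sSup_ratio_sub_le {J K P : H →L[ℝ] H} {U : Submodule ℝ H}
    {ρ σ δ ε μ μbar : ℝ} (hJ : ∀ x, ‖J x‖ = ‖x‖)
    (hsurj : ∀ y, ∃ x, x + K x = y) (hρ0 : 0 < ρ) (hρ : ∀ x, ‖x‖ ≤ ρ * ‖x + K x‖)
    (hσ0 : 0 ≤ σ) (hσ : ∀ x, ‖x + K x‖ ≤ σ * ‖x‖) (hP : ∀ x, ‖P x‖ ≤ ‖x‖)
    (hδ : 0 < δ) (happ : ∀ x, ∃ u ∈ U, ‖K x - u‖ ≤ δ * ‖x‖)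
    (hμ : 0 < μ) (hμbar : μ ≤ μbar) (hε : 0 < ε)
    (hlow : ∀ ψ ∈ U, ‖ψ‖ ≤ μ * ‖P (J ψ)‖)
    (hatt : ∀ η > (0 : ℝ), ∃ ψ ∈ U, ‖ψ‖ = 1 ∧ ‖P (J ψ)‖ ≤ 1 / μ + η)
    (hδ₁ : (μbar + 1) * ρ * δ * (μbar + ε) ≤ ε)
    (hδ₂ : σ * ρ * δ + μbar * (1 + σ * ρ) * δ ≤ ε / μbar) (hδ₃ : σ * ρ * δ < 1) :
    |sSup {r : ℝ | ∃ φ ∈ U, φ ≠ 0 ∧ r = ‖J (φ + K φ)‖ / ‖P (J (φ + K φ))‖} - μ| ≤ ε := by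
  have hμb : 0 < μbar := hμ.trans_le hμbar
  have ht : (μbar + 1) * ρ * δ < 1 := by
    by_contra hcon
    nlinarith
  have hup : ∀ φ ∈ U,
      (1 - (μbar + 1) * ρ * δ) * ‖J (φ + K φ)‖ ≤ μ * ‖P (J (φ + K φ))‖ := by
    intro φ hφ
    obtain ⟨u, hu, hKu⟩ := happ φ
    have h1 := hlow (φ + u) (U.add_mem hφ hu)
    have h2 : φ + K φ = (φ + u) + (K φ - u) := by abel
    have h3 : ‖φ + K φ‖ ≤ ‖φ + u‖ + ‖K φ - u‖ := h2 ▸ norm_add_le _ _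
    have h4 : ‖P (J (φ + u))‖ ≤ ‖P (J (φ + K φ))‖ + ‖K φ - u‖ := by
      have h5 : P (J (φ + u)) = P (J (φ + K φ)) - P (J (K φ - u)) := by
        rw [← map_sub, ← map_sub]; congr 2; abel
      have h6 : ‖P (J (K φ - u))‖ ≤ ‖K φ - u‖ := (hP _).trans (hJ _).le
      rw [h5]
      exact (norm_sub_le _ _).trans (by linarith)
    have h7 : ‖K φ - u‖ ≤ δ * (ρ * ‖φ + K φ‖) :=
      hKu.trans (mul_le_mul_of_nonneg_left (hρ φ) hδ.le)
    rw [hJ]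
    have h8 : (μ + 1) * ‖K φ - u‖ ≤ (μbar + 1) * (δ * (ρ * ‖φ + K φ‖)) :=
      mul_le_mul (by linarith) h7 (norm_nonneg _) (by linarith)
    nlinarith [mul_le_mul_of_nonneg_left h4 hμ.le]
  set A : Set ℝ := {r : ℝ | ∃ φ ∈ U, φ ≠ 0 ∧ r = ‖J (φ + K φ)‖ / ‖P (J (φ + K φ))‖} with hA
  have hle : ∀ r ∈ A, r ≤ μ + ε := by
    rintro r ⟨φ, hφ, hφ0, rfl⟩
    refine div_le_of_le_mul₀ (norm_nonneg _) (by positivity) ?_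
    have h1 := hup φ hφ
    have h2 : μ ≤ (μ + ε) * (1 - (μbar + 1) * ρ * δ) := by
      have : (μbar + 1) * ρ * δ * (μ + ε) ≤ (μbar + 1) * ρ * δ * (μbar + ε) := by gcongr
      linarith
    have h3 : 0 < 1 - (μbar + 1) * ρ * δ := by linarith
    have h4 := mul_le_mul_of_nonneg_right h2 (norm_nonneg (P (J (φ + K φ))))
    refine le_of_mul_le_mul_left ?_ h3
    linarith
  have hubd : sSup A ≤ μ + ε := Real.sSup_le hle (by positivity)
  obtain ⟨ψ, hψ, hψ1, hPψ⟩ := hatt δ hδ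
  obtain ⟨χ, hχ⟩ := hsurj ψ
  obtain ⟨u, hu, hKu⟩ := happ χ
  have hχn : ‖χ‖ ≤ ρ := by simpa [hχ, hψ1] using hρ χ
  have hφ : ψ - u ∈ U := U.sub_mem hψ hu
  have hd : ‖(ψ - u) + K (ψ - u) - ψ‖ ≤ σ * ρ * δ := by
    have h1 : (ψ - u) + K (ψ - u) - ψ = (K χ - u) + K (K χ - u) := by
      rw [← hχ]; simp only [map_sub, map_add]; abel
    rw [h1]
    calc _ ≤ σ * ‖K χ - u‖ := hσ _
      _ ≤ σ * (δ * ρ) := by gcongr; exact hKu.trans (by gcongr)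
      _ = _ := by ring
  set w := (ψ - u) + K (ψ - u) with hw
  have hwn : 1 - σ * ρ * δ ≤ ‖w‖ := by
    have := norm_sub_norm_le ψ w
    rw [norm_sub_rev] at this
    linarith
  have hPw : ‖P (J w)‖ ≤ 1 / μ + δ + σ * ρ * δ := by
    have h1 : P (J w) = P (J ψ) + P (J (w - ψ)) := by rw [← map_add, ← map_add]; congr 2; abel
    have h2 : ‖P (J (w - ψ))‖ ≤ ‖w - ψ‖ := (hP _).trans (hJ _).le
    rw [h1]
    exact (norm_add_le _ _).trans (by linarith)
  have hφ0 : ψ - u ≠ 0 := by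
    intro h
    rw [hw, h, map_zero, add_zero, norm_zero] at hwn
    linarith
  have hPpos : 0 < ‖P (J w)‖ := by
    have h1 := hup _ hφ
    rw [← hw, hJ] at h1
    have h2 : 0 < (1 - (μbar + 1) * ρ * δ) * ‖w‖ := mul_pos (by linarith) (by linarith)
    exact pos_of_mul_pos_right (h2.trans_le h1) hμ.le
  have hmem : ‖J w‖ / ‖P (J w)‖ ≤ sSup A := le_csSup ⟨_, hle⟩ ⟨ψ - u, hφ, hφ0, rfl⟩
  have hlb : μ - ε ≤ ‖J w‖ / ‖P (J w)‖ := by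
    rcases le_or_gt (μ - ε) 0 with h0 | h0
    · exact h0.trans (by positivity)
    rw [le_div_iff₀ hPpos, hJ]
    have h1 : (μ - ε) * (1 / μ + δ + σ * ρ * δ) =
        1 - ε / μ + (μ - ε) * ((1 + σ * ρ) * δ) := by field_simp; ring
    have h2 : ε / μbar ≤ ε / μ := by gcongr
    have h3 : (μ - ε) * ((1 + σ * ρ) * δ) ≤ μbar * ((1 + σ * ρ) * δ) := by
      gcongr; linarith
    calc _ ≤ (μ - ε) * (1 / μ + δ + σ * ρ * δ) := by gcongr
      _ ≤ 1 - σ * ρ * δ := by rw [h1]; linarith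
      _ ≤ _ := hwn
  rw [abs_le]
  constructor <;> linarith

end CompactPerturbation

theorem nV_eq_norm_toLp_s8 {E F : Type*} [NormedAddCommGroup E] [NormedAddCommGroup F] (v : E × F) :
    nV v = ‖WithLp.toLp 2 v‖ :=
  (WithLp.prod_norm_eq_of_L2 (WithLp.toLp 2 v)).symm

theorem LinearIsometryEquiv.real_inner_symm_apply {E F : Type*}
    [NormedAddCommGroup E] [InnerProductSpace ℝ E] [NormedAddCommGroup F] [InnerProductSpace ℝ F]
    (T : F ≃ₗᵢ[ℝ] E) (x : E) (y : F) : ⟪y, T.symm x⟫ = ⟪x, T y⟫ := by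
  rw [real_inner_comm (T y) x, ← T.inner_map_map y, T.apply_symm_apply]

section ProductSpace

variable {V₁ V₂ Q W : Type*}
  [NormedAddCommGroup V₁] [InnerProductSpace ℝ V₁]
  [NormedAddCommGroup V₂] [InnerProductSpace ℝ V₂]
  [NormedAddCommGroup Q] [InnerProductSpace ℝ Q]
  [NormedAddCommGroup W] [InnerProductSpace ℝ W]

/-- A bilinear form inducing the norm of `V₂` and nondegenerate in its first argument is the inner
product of `V₁` composed with an isometric isomorphism. -/
theorem exists_linearIsometryEquiv_of_adjoint_norm [CompleteSpace V₁] [CompleteSpace V₂]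
    (a : V₁ →L[ℝ] V₂ →L[ℝ] ℝ) (hnd : ∀ v₁ : V₁, (∀ v₂ : V₂, a v₁ v₂ = 0) → v₁ = 0)
    (hadj : ∀ v₂ : V₂, ‖v₂‖ = sSup {r : ℝ | ∃ φ₁ : V₁, ‖φ₁‖ = 1 ∧ r = a φ₁ v₂}) :
    ∃ T : V₂ ≃ₗᵢ[ℝ] V₁, ∀ v₁ v₂, a v₁ v₂ = ⟪v₁, T v₂⟫ := by
  let F : V₂ →ₗ[ℝ] V₁ :=
    { toFun := fun v => (InnerProductSpace.toDual ℝ V₁).symm (a.flip v)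
      map_add' := fun x y => by simp
      map_smul' := fun c x => by simp }
  have hF : ∀ v₁ v₂, a v₁ v₂ = ⟪v₁, F v₂⟫ := fun v₁ v₂ => by
    rw [real_inner_comm]
    exact (InnerProductSpace.toDual_symm_apply (𝕜 := ℝ) (x := v₁) (y := a.flip v₂)).symm
  have hFn : ∀ v, ‖F v‖ = ‖v‖ := fun v => by
    rw [hadj v]
    simp only [hF]
    have h := sSup_inner_eq_norm_starProjection (⊤ : Submodule ℝ V₁) (F v)
    simp only [Submodule.mem_top, true_and, Submodule.starProjection_top,
      ContinuousLinearMap.id_apply] at h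
    exact h.symm
  let Fi : V₂ →ₗᵢ[ℝ] V₁ := ⟨F, hFn⟩
  have hcl : IsClosed (Set.range Fi) := Fi.isometry.isClosedEmbedding.isClosed_range
  have hcomp : IsComplete ((LinearMap.range F : Submodule ℝ V₁) : Set V₁) := hcl.isComplete
  have : CompleteSpace (LinearMap.range F) := hcomp.completeSpace_coe
  have htop : LinearMap.range F = ⊤ := by
    rw [← Submodule.orthogonal_eq_bot_iff, Submodule.eq_bot_iff]
    intro x hx
    refine hnd x fun v => ?_
    rw [hF, real_inner_comm]
    exact (Submodule.mem_orthogonal _ _).1 hx _ ⟨v, rfl⟩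
  exact ⟨LinearIsometryEquiv.ofSurjective Fi (LinearMap.range_eq_top.1 htop), hF⟩

theorem discInfSup_eq_sInf_norm {a : V₁ →L[ℝ] V₂ →L[ℝ] ℝ} {T : V₂ ≃ₗᵢ[ℝ] V₁}
    (hT : ∀ v₁ v₂, a v₁ v₂ = ⟪v₁, T v₂⟫) (U₁ : Submodule ℝ V₁) (U₂ : Submodule ℝ V₂)
    [U₂.HasOrthogonalProjection] :
    discInfSup a U₁ U₂ =
      sInf {r : ℝ | ∃ v₁ ∈ U₁, ‖v₁‖ = 1 ∧ r = ‖U₂.starProjection (T.symm v₁)‖} := by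
  have h : ∀ v₁ v₂, a v₁ v₂ = ⟪v₂, T.symm v₁⟫ := fun v₁ v₂ => by
    rw [hT, T.real_inner_symm_apply]
  simp only [discInfSup, h, sSup_inner_eq_norm_starProjection]

/-- The inf-sup bound on the first factor. -/
theorem norm_le_mul_norm_starProjection_symm {T : V₂ ≃ₗᵢ[ℝ] V₁} {U₁ : Submodule ℝ V₁}
    {U₂ : Submodule ℝ V₂} [U₂.HasOrthogonalProjection] {μ : ℝ} (hμ0 : 0 < μ)
    (hμ : 1 / μ = sInf {r : ℝ | ∃ v₁ ∈ U₁, ‖v₁‖ = 1 ∧ r = ‖U₂.starProjection (T.symm v₁)‖})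
    {v : V₁} (hv : v ∈ U₁) : ‖v‖ ≤ μ * ‖U₂.starProjection (T.symm v)‖ := by
  rcases eq_or_ne v 0 with rfl | h0
  · simp
  have hn : 0 < ‖v‖ := norm_pos_iff.2 h0
  have h1 : 1 / μ ≤ ‖U₂.starProjection (T.symm (‖v‖⁻¹ • v))‖ := by
    rw [hμ]
    refine csInf_le ⟨0, ?_⟩ ⟨‖v‖⁻¹ • v, U₁.smul_mem _ hv, ?_, rfl⟩
    · rintro r ⟨w, -, -, rfl⟩
      exact norm_nonneg _
    · rw [norm_smul, norm_inv, norm_norm, inv_mul_cancel₀ hn.ne']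
  rw [map_smul, map_smul, norm_smul, norm_inv, norm_norm, inv_mul_eq_div, div_le_div_iff₀ hμ0 hn]
    at h1
  linarith

/-- The inf-sup bound transfers to the second factor with the same constant. -/
theorem norm_le_mul_norm_starProjection {T : V₂ ≃ₗᵢ[ℝ] V₁} {U₁ : Submodule ℝ V₁}
    {U₂ : Submodule ℝ V₂} [FiniteDimensional ℝ U₂] [U₁.HasOrthogonalProjection] {μ : ℝ}
    (hμ0 : 0 < μ)
    (hnd : ∀ v₂ ∈ U₂, (∀ φ₁ ∈ U₁, ⟪φ₁, T v₂⟫ = 0) → v₂ = 0)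
    (hlow : ∀ v ∈ U₁, ‖v‖ ≤ μ * ‖U₂.starProjection (T.symm v)‖)
    {φ : V₂} (hφ : φ ∈ U₂) : ‖φ‖ ≤ μ * ‖U₁.starProjection (T φ)‖ := by
  have hpr : ∀ y ∈ U₂, ∀ x, ⟪y, U₂.starProjection x⟫ = ⟪y, x⟫ := fun y hy x => by
    rw [← Submodule.inner_starProjection_left_eq_right, Submodule.starProjection_eq_self_iff.2 hy]
  let R : Submodule ℝ V₂ :=
    U₁.map ((U₂.starProjection : V₂ →ₗ[ℝ] V₂) ∘ₗ (T.symm.toLinearEquiv : V₁ →ₗ[ℝ] V₂))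
  have hRU : R ≤ U₂ := by
    rintro _ ⟨x, -, rfl⟩
    exact U₂.starProjection_apply_mem _
  have : FiniteDimensional ℝ R := Submodule.finiteDimensional_of_le hRU
  have hφR : φ ∈ R := by
    have h0 : φ - R.starProjection φ = 0 := by
      refine hnd _ (U₂.sub_mem hφ (hRU (R.starProjection_apply_mem φ))) fun x hx => ?_
      rw [← T.real_inner_symm_apply, ← hpr _ (U₂.sub_mem hφ (hRU (R.starProjection_apply_mem φ))), real_inner_comm]
      exact (Submodule.mem_orthogonal _ _).1 (R.sub_starProjection_mem_orthogonal φ) _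
        ⟨x, hx, rfl⟩
    rw [sub_eq_zero.1 h0]
    exact R.starProjection_apply_mem φ
  obtain ⟨x, hx, hxφ⟩ := hφR
  replace hxφ : U₂.starProjection (T.symm x) = φ := hxφ
  rcases eq_or_ne φ 0 with h0 | h0
  · rw [h0, norm_zero]; positivity
  have hn : 0 < ‖φ‖ := norm_pos_iff.2 h0
  have h1 : ‖φ‖ ^ 2 = ⟪x, U₁.starProjection (T φ)⟫ := by
    rw [← real_inner_self_eq_norm_sq]
    nth_rewrite 2 [← hxφ]
    rw [hpr _ hφ, T.real_inner_symm_apply, ← Submodule.inner_starProjection_left_eq_right,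
      Submodule.starProjection_eq_self_iff.2 hx]
  have h2 := real_inner_le_norm x (U₁.starProjection (T φ))
  have h3 := hlow x hx
  rw [hxφ] at h3
  have h4 := mul_le_mul_of_nonneg_right h3 (norm_nonneg (U₁.starProjection (T φ)))
  refine le_of_mul_le_mul_left ?_ hn
  nlinarith

/-- The subspace `U₁ × U₂` of the `ℓ²`-product. -/
def prodSubmodule (U₁ : Submodule ℝ V₁) (U₂ : Submodule ℝ V₂) :
    Submodule ℝ (WithLp 2 (V₁ × V₂)) :=
  (U₁.prod U₂).comap (WithLp.linearEquiv 2 ℝ (V₁ × V₂)).toLinearMap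

theorem sub_toLp_starProjection_mem_orthogonal (U₁ : Submodule ℝ V₁) (U₂ : Submodule ℝ V₂)
    [U₁.HasOrthogonalProjection] [U₂.HasOrthogonalProjection] (x : WithLp 2 (V₁ × V₂)) :
    x - WithLp.toLp 2 (U₁.starProjection x.fst, U₂.starProjection x.snd) ∈
      (prodSubmodule U₁ U₂)ᗮ := by
  rw [Submodule.mem_orthogonal]
  intro u hu
  rw [WithLp.prod_inner_apply]
  have h1 := (Submodule.mem_orthogonal _ _).1 (U₁.sub_starProjection_mem_orthogonal x.fst) _ hu.1
  have h2 := (Submodule.mem_orthogonal _ _).1 (U₂.sub_starProjection_mem_orthogonal x.snd) _ hu.2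
  exact (congrArg₂ (· + ·) h1 h2).trans (add_zero 0)

instance (U₁ : Submodule ℝ V₁) (U₂ : Submodule ℝ V₂)
    [U₁.HasOrthogonalProjection] [U₂.HasOrthogonalProjection] :
    (prodSubmodule U₁ U₂).HasOrthogonalProjection :=
  ⟨fun x => ⟨WithLp.toLp 2 (U₁.starProjection x.fst, U₂.starProjection x.snd), ⟨U₁.starProjection_apply_mem x.fst, U₂.starProjection_apply_mem x.snd⟩,
    sub_toLp_starProjection_mem_orthogonal U₁ U₂ x⟩⟩

theorem starProjection_prodSubmodule (U₁ : Submodule ℝ V₁) (U₂ : Submodule ℝ V₂)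
    [U₁.HasOrthogonalProjection] [U₂.HasOrthogonalProjection] (x : WithLp 2 (V₁ × V₂)) :
    (prodSubmodule U₁ U₂).starProjection x =
      WithLp.toLp 2 (U₁.starProjection x.fst, U₂.starProjection x.snd) :=
  Submodule.eq_starProjection_of_mem_orthogonal
    ⟨U₁.starProjection_apply_mem x.fst, U₂.starProjection_apply_mem x.snd⟩
    (sub_toLp_starProjection_mem_orthogonal U₁ U₂ x)

/-- The operator on the `ℓ²`-product swapping the two factors along `T`. -/
def swapOp (T : V₂ ≃ₗᵢ[ℝ] V₁) : WithLp 2 (V₁ × V₂) →L[ℝ] WithLp 2 (V₁ × V₂) :=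
  ((WithLp.prodContinuousLinearEquiv 2 ℝ V₁ V₂).symm : V₁ × V₂ →L[ℝ] WithLp 2 (V₁ × V₂)) ∘L
    (((T : V₂ →L[ℝ] V₁) ∘L WithLp.sndL 2 ℝ V₁ V₂).prod
      ((T.symm : V₁ →L[ℝ] V₂) ∘L WithLp.fstL 2 ℝ V₁ V₂))

theorem swapOp_apply (T : V₂ ≃ₗᵢ[ℝ] V₁) (x : WithLp 2 (V₁ × V₂)) :
    swapOp T x = WithLp.toLp 2 (T x.snd, T.symm x.fst) := rfl

theorem norm_swapOp_apply (T : V₂ ≃ₗᵢ[ℝ] V₁) (x : WithLp 2 (V₁ × V₂)) : ‖swapOp T x‖ = ‖x‖ := by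
  rw [swapOp_apply, WithLp.prod_norm_eq_of_L2, WithLp.prod_norm_eq_of_L2 x, add_comm]
  simp

theorem norm_le_mul_norm_starProjection_swapOp {T : V₂ ≃ₗᵢ[ℝ] V₁} {U₁ : Submodule ℝ V₁}
    {U₂ : Submodule ℝ V₂} [U₁.HasOrthogonalProjection] [U₂.HasOrthogonalProjection] {μ : ℝ}
    (hlow₁ : ∀ v ∈ U₁, ‖v‖ ≤ μ * ‖U₂.starProjection (T.symm v)‖)
    (hlow₂ : ∀ v ∈ U₂, ‖v‖ ≤ μ * ‖U₁.starProjection (T v)‖) (hμ : 0 ≤ μ)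
    {ψ : WithLp 2 (V₁ × V₂)} (hψ : ψ ∈ prodSubmodule U₁ U₂) :
    ‖ψ‖ ≤ μ * ‖(prodSubmodule U₁ U₂).starProjection (swapOp T ψ)‖ := by
  refine le_of_sq_le_sq ?_ (by positivity)
  rw [mul_pow, starProjection_prodSubmodule, swapOp_apply, WithLp.prod_norm_sq_eq_of_L2,
    WithLp.prod_norm_sq_eq_of_L2]
  have h₁ := pow_le_pow_left₀ (norm_nonneg _) (hlow₁ ψ.fst hψ.1) 2
  have h₂ := pow_le_pow_left₀ (norm_nonneg _) (hlow₂ ψ.snd hψ.2) 2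
  rw [mul_pow] at h₁ h₂
  exact (add_le_add h₁ h₂).trans (le_of_eq (by simp only [WithLp.toLp_fst, WithLp.toLp_snd]; ring))

theorem exists_norm_eq_one_norm_starProjection_swapOp_le {T : V₂ ≃ₗᵢ[ℝ] V₁} {U₁ : Submodule ℝ V₁}
    {U₂ : Submodule ℝ V₂} [U₁.HasOrthogonalProjection] [U₂.HasOrthogonalProjection] {μ : ℝ}
    (hμ0 : 0 < μ)
    (hμ : 1 / μ = sInf {r : ℝ | ∃ v₁ ∈ U₁, ‖v₁‖ = 1 ∧ r = ‖U₂.starProjection (T.symm v₁)‖})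
    {η : ℝ} (hη : 0 < η) :
    ∃ ψ ∈ prodSubmodule U₁ U₂, ‖ψ‖ = 1 ∧
      ‖(prodSubmodule U₁ U₂).starProjection (swapOp T ψ)‖ ≤ 1 / μ + η := by
  have hne : {r : ℝ | ∃ v₁ ∈ U₁, ‖v₁‖ = 1 ∧ r = ‖U₂.starProjection (T.symm v₁)‖}.Nonempty := by
    by_contra h
    rw [Set.not_nonempty_iff_eq_empty.1 h, Real.sInf_empty] at hμ
    exact (one_div_pos.2 hμ0).ne' hμ
  obtain ⟨_, ⟨v, hv, hv1, rfl⟩, hlt⟩ := exists_lt_of_csInf_lt hne (b := 1 / μ + η) (by linarith)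
  refine ⟨WithLp.toLp 2 (v, 0), ⟨hv, U₂.zero_mem⟩, ?_, ?_⟩
  · rw [WithLp.prod_norm_eq_of_L2]; simp [hv1]
  · rw [starProjection_prodSubmodule, swapOp_apply, WithLp.prod_norm_eq_of_L2]
    simpa using hlt.le

/-- The compact perturbation: `b(v, φ) = ⟪v, J (φ + K φ)⟫` with `J = swapOp T` and `K` this
operator. -/
noncomputable def pertOp [CompleteSpace V₁] [CompleteSpace V₂] [CompleteSpace Q] [CompleteSpace W]
    (T : V₂ ≃ₗᵢ[ℝ] V₁) (Cs : V₂ →L[ℝ] Q) (Iop : V₁ →L[ℝ] W) (α : ℝ) :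
    WithLp 2 (V₁ × V₂) →L[ℝ] WithLp 2 (V₁ × V₂) :=
  (Real.sqrt α)⁻¹ •
    ((((WithLp.prodContinuousLinearEquiv 2 ℝ V₁ V₂).symm : V₁ × V₂ →L[ℝ] WithLp 2 (V₁ × V₂)) ∘L
        ContinuousLinearMap.inl ℝ V₁ V₂ ∘L (T : V₂ →L[ℝ] V₁) ∘L
        ContinuousLinearMap.adjoint Cs) ∘L (Cs ∘L WithLp.sndL 2 ℝ V₁ V₂) -
      (((WithLp.prodContinuousLinearEquiv 2 ℝ V₁ V₂).symm : V₁ × V₂ →L[ℝ] WithLp 2 (V₁ × V₂)) ∘L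
        ContinuousLinearMap.inr ℝ V₁ V₂ ∘L (T.symm : V₁ →L[ℝ] V₂) ∘L
        ContinuousLinearMap.adjoint Iop) ∘L (Iop ∘L WithLp.fstL 2 ℝ V₁ V₂))

variable [CompleteSpace V₁] [CompleteSpace V₂] [CompleteSpace Q] [CompleteSpace W]

theorem pertOp_apply (T : V₂ ≃ₗᵢ[ℝ] V₁) (Cs : V₂ →L[ℝ] Q) (Iop : V₁ →L[ℝ] W) (α : ℝ)
    (x : WithLp 2 (V₁ × V₂)) :
    pertOp T Cs Iop α x = WithLp.toLp 2
      ((Real.sqrt α)⁻¹ • T (ContinuousLinearMap.adjoint Cs (Cs x.snd)),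
        -((Real.sqrt α)⁻¹ • T.symm (ContinuousLinearMap.adjoint Iop (Iop x.fst)))) := by
  change (Real.sqrt α)⁻¹ • (WithLp.toLp 2 (T (ContinuousLinearMap.adjoint Cs (Cs x.snd)), (0 : V₂))
    - WithLp.toLp 2 ((0 : V₁), T.symm (ContinuousLinearMap.adjoint Iop (Iop x.fst)))) = _
  rw [← WithLp.toLp_sub, ← WithLp.toLp_smul]
  simp

theorem isCompactOperator_pertOp (T : V₂ ≃ₗᵢ[ℝ] V₁) {Cs : V₂ →L[ℝ] Q} {Iop : V₁ →L[ℝ] W} (α : ℝ)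
    (hCc : IsCompactOperator Cs) (hIc : IsCompactOperator Iop) :
    IsCompactOperator (pertOp T Cs Iop α) :=
  IsCompactOperator.smul (IsCompactOperator.sub
    (IsCompactOperator.clm_comp (hCc.comp_clm (WithLp.sndL 2 ℝ V₁ V₂))
      (((WithLp.prodContinuousLinearEquiv 2 ℝ V₁ V₂).symm : V₁ × V₂ →L[ℝ] WithLp 2 (V₁ × V₂)) ∘L
        ContinuousLinearMap.inl ℝ V₁ V₂ ∘L (T : V₂ →L[ℝ] V₁) ∘L ContinuousLinearMap.adjoint Cs))
    (IsCompactOperator.clm_comp (hIc.comp_clm (WithLp.fstL 2 ℝ V₁ V₂))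
      (((WithLp.prodContinuousLinearEquiv 2 ℝ V₁ V₂).symm : V₁ × V₂ →L[ℝ] WithLp 2 (V₁ × V₂)) ∘L
        ContinuousLinearMap.inr ℝ V₁ V₂ ∘L (T.symm : V₁ →L[ℝ] V₂) ∘L
        ContinuousLinearMap.adjoint Iop))) (Real.sqrt α)⁻¹

theorem bV_eq_inner {a : V₁ →L[ℝ] V₂ →L[ℝ] ℝ} {T : V₂ ≃ₗᵢ[ℝ] V₁}
    (hT : ∀ v₁ v₂, a v₁ v₂ = ⟪v₁, T v₂⟫) (Cs : V₂ →L[ℝ] Q) (Iop : V₁ →L[ℝ] W) (α : ℝ)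
    (v φ : WithLp 2 (V₁ × V₂)) :
    bV a Cs Iop α (WithLp.ofLp v) (WithLp.ofLp φ) =
      ⟪v, swapOp T (φ + pertOp T Cs Iop α φ)⟫ := by
  rw [WithLp.prod_inner_apply, swapOp_apply, pertOp_apply]
  simp only [bV, aV, hT, WithLp.ofLp_fst, WithLp.ofLp_snd, WithLp.add_fst, WithLp.add_snd, WithLp.toLp_fst,
    WithLp.toLp_snd, map_add,
    map_neg, map_smul, LinearIsometryEquiv.apply_symm_apply, LinearIsometryEquiv.symm_apply_apply,
    inner_add_right, inner_neg_right, real_inner_smul_right, ContinuousLinearMap.adjoint_inner_right,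
    T.real_inner_symm_apply]
  ring

theorem eq_zero_of_add_pertOp_eq_zero {a : V₁ →L[ℝ] V₂ →L[ℝ] ℝ} {T : V₂ ≃ₗᵢ[ℝ] V₁}
    (hT : ∀ v₁ v₂, a v₁ v₂ = ⟪v₁, T v₂⟫) (Cs : V₂ →L[ℝ] Q) (Iop : V₁ →L[ℝ] W) {α : ℝ}
    (hα : 0 < α) (φ : WithLp 2 (V₁ × V₂)) (h : φ + pertOp T Cs Iop α φ = 0) : φ = 0 := by
  have hb := bV_eq_inner hT Cs Iop α (WithLp.toLp 2 (-φ.fst, φ.snd)) φ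
  rw [h, map_zero, inner_zero_right] at hb
  have hs : 0 < (Real.sqrt α)⁻¹ := inv_pos.2 (Real.sqrt_pos.2 hα)
  simp only [bV, aV, WithLp.ofLp_fst, WithLp.ofLp_snd, map_neg, neg_apply,
    inner_neg_left, real_inner_self_eq_norm_sq, neg_add_cancel, zero_add, sub_neg_eq_add,
    mul_eq_zero, hs.ne', false_or] at hb
  have hC : Cs φ.snd = 0 := by
    rw [← norm_eq_zero]; nlinarith [sq_nonneg ‖Iop φ.fst‖, sq_nonneg ‖Cs φ.snd‖]
  have hI : Iop φ.fst = 0 := by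
    rw [← norm_eq_zero]; nlinarith [sq_nonneg ‖Iop φ.fst‖, sq_nonneg ‖Cs φ.snd‖]
  have hK : pertOp T Cs Iop α φ = 0 := by
    rw [pertOp_apply, hC, hI]; simp
  simpa [hK] using h

theorem nuConst_eq_sSup_norm {a : V₁ →L[ℝ] V₂ →L[ℝ] ℝ} {T : V₂ ≃ₗᵢ[ℝ] V₁}
    (hT : ∀ v₁ v₂, a v₁ v₂ = ⟪v₁, T v₂⟫) (Cs : V₂ →L[ℝ] Q) (Iop : V₁ →L[ℝ] W) (α : ℝ)
    (U₁ : Submodule ℝ V₁) (U₂ : Submodule ℝ V₂)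
    [U₁.HasOrthogonalProjection] [U₂.HasOrthogonalProjection] :
    nuConst a Cs Iop α U₁ U₂ = sSup {r : ℝ | ∃ φ ∈ prodSubmodule U₁ U₂, φ ≠ 0 ∧
      r = ‖swapOp T (φ + pertOp T Cs Iop α φ)‖ /
        ‖(prodSubmodule U₁ U₂).starProjection (swapOp T (φ + pertOp T Cs Iop α φ))‖} := by
  have hnum : ∀ φ : WithLp 2 (V₁ × V₂),
      sSup {s : ℝ | ∃ v : V₁ × V₂, nV v = 1 ∧ s = bV a Cs Iop α v (WithLp.ofLp φ)} =
        ‖swapOp T (φ + pertOp T Cs Iop α φ)‖ := fun φ => by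
    have h := sSup_inner_eq_norm_starProjection (⊤ : Submodule ℝ (WithLp 2 (V₁ × V₂)))
      (swapOp T (φ + pertOp T Cs Iop α φ))
    simp only [Submodule.mem_top, true_and, Submodule.starProjection_top,
      ContinuousLinearMap.id_apply] at h
    rw [← h]
    congr 1
    ext s
    constructor
    · rintro ⟨v, hv, rfl⟩
      exact ⟨WithLp.toLp 2 v, (nV_eq_norm_toLp_s8 v).symm.trans hv, bV_eq_inner hT Cs Iop α _ φ⟩
    · rintro ⟨v, hv, rfl⟩
      exact ⟨WithLp.ofLp v, (nV_eq_norm_toLp_s8 _).trans hv, (bV_eq_inner hT Cs Iop α _ φ).symm⟩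
  have hden : ∀ φ : WithLp 2 (V₁ × V₂),
      sSup {s : ℝ | ∃ v : V₁ × V₂, v.1 ∈ U₁ ∧ v.2 ∈ U₂ ∧ nV v = 1 ∧
          s = bV a Cs Iop α v (WithLp.ofLp φ)} =
        ‖(prodSubmodule U₁ U₂).starProjection (swapOp T (φ + pertOp T Cs Iop α φ))‖ := fun φ => by
    rw [← sSup_inner_eq_norm_starProjection]
    congr 1
    ext s
    constructor
    · rintro ⟨v, hv₁, hv₂, hv, rfl⟩
      exact ⟨WithLp.toLp 2 v, ⟨hv₁, hv₂⟩, (nV_eq_norm_toLp_s8 v).symm.trans hv,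
        bV_eq_inner hT Cs Iop α _ φ⟩
    · rintro ⟨v, hvm, hv, rfl⟩
      exact ⟨WithLp.ofLp v, hvm.1, hvm.2, (nV_eq_norm_toLp_s8 _).trans hv,
        (bV_eq_inner hT Cs Iop α _ φ).symm⟩
  simp only [nuConst]
  congr 1
  ext r
  constructor
  · rintro ⟨φ, h₁, h₂, h0, rfl⟩
    refine ⟨WithLp.toLp 2 φ, ⟨h₁, h₂⟩, fun h => h0 ((WithLp.toLp_eq_zero 2).1 h), ?_⟩
    rw [← hnum, ← hden]
  · rintro ⟨φ, hφ, h0, rfl⟩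
    refine ⟨WithLp.ofLp φ, hφ.1, hφ.2, fun h => h0 ((WithLp.ofLp_eq_zero 2).1 h), ?_⟩
    rw [hnum, hden]

end ProductSpace

/-- Lemma 3.6, qualitative asymptotic quasi-best approximation:
`ν_h = μ_h (1 + κ̄ o(1))` as `h → 0`. -/
theorem stmt8
    {V₁ V₂ Q W : Type*}
    [NormedAddCommGroup V₁] [InnerProductSpace ℝ V₁] [CompleteSpace V₁] [Nontrivial V₁]
    [NormedAddCommGroup V₂] [InnerProductSpace ℝ V₂] [CompleteSpace V₂] [Nontrivial V₂]
    [NormedAddCommGroup Q] [InnerProductSpace ℝ Q] [CompleteSpace Q]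
    [NormedAddCommGroup W] [InnerProductSpace ℝ W] [CompleteSpace W]
    (a : V₁ →L[ℝ] V₂ →L[ℝ] ℝ) (Cs : V₂ →L[ℝ] Q) (Iop : V₁ →L[ℝ] W)
    (α m_a M_C M_I M L : ℝ) (hα : 0 < α)
    (hma : m_a = infSupConst a) (hma_pos : 0 < m_a)
    (hnd : ∀ v₁ : V₁, (∀ v₂ : V₂, a v₁ v₂ = 0) → v₁ = 0)
    (hadj : ∀ v₂ : V₂, ‖v₂‖ = sSup {r : ℝ | ∃ φ₁ : V₁, ‖φ₁‖ = 1 ∧ r = a φ₁ v₂})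
    (hMC : M_C = ‖Cs‖) (hMI : M_I = ‖Iop‖) (hM : M = max M_I M_C)
    (hL : L = M / Real.sqrt α)
    -- compactness of the observation and control-action operators
    (hIc : IsCompactOperator (⇑Iop)) (hCc : IsCompactOperator (⇑Cs))
    -- family of discretizations
    (Vh1 : ℝ → Submodule ℝ V₁) (Vh2 : ℝ → Submodule ℝ V₂)
    (hfd1 : ∀ h > (0 : ℝ), FiniteDimensional ℝ (Vh1 h))
    (hfd2 : ∀ h > (0 : ℝ), FiniteDimensional ℝ (Vh2 h))
    (hndh1 : ∀ h > (0 : ℝ), ∀ v₁ ∈ Vh1 h, (∀ φ₂ ∈ Vh2 h, a v₁ φ₂ = 0) → v₁ = 0)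
    (hndh2 : ∀ h > (0 : ℝ), ∀ v₂ ∈ Vh2 h, (∀ φ₁ ∈ Vh1 h, a φ₁ v₂ = 0) → v₂ = 0)
    (μ ν : ℝ → ℝ) (μbar κbar : ℝ)
    (hμ_pos : ∀ h > (0 : ℝ), 0 < μ h)
    (hμ : ∀ h > (0 : ℝ), 1 / μ h = discInfSup a (Vh1 h) (Vh2 h))
    (hν : ∀ h > (0 : ℝ), ν h = nuConst a Cs Iop α (Vh1 h) (Vh2 h))
    -- uniform stability
    (hstab : ∀ h > (0 : ℝ), μ h ≤ μbar)
    (hκbar : κbar = ((1 + 2 * L) / (1 + L)) * (1 + M * (1 + 2 * M / Real.sqrt α) * μbar))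
    -- approximability
    (happrox : ∀ v : V₁ × V₂,
      Tendsto (fun h => bestErr (Vh1 h) (Vh2 h) v) (𝓝[>] (0 : ℝ)) (𝓝 0)) :
    ∃ ε : ℝ → ℝ, (∀ h, 0 ≤ ε h) ∧ Tendsto ε (𝓝[>] (0 : ℝ)) (𝓝 0) ∧
      ∀ h > (0 : ℝ), |ν h - μ h| ≤ κbar * μ h * ε h := by
  obtain ⟨T, hT⟩ := exists_linearIsometryEquiv_of_adjoint_norm a hnd hadj
  have hμbar : 0 < μbar := (hμ_pos 1 one_pos).trans_le (hstab 1 one_pos)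
  have hM0 : 0 ≤ M := by rw [hM, hMI]; exact le_max_of_le_left (norm_nonneg _)
  have hL0 : 0 ≤ L := by rw [hL]; positivity
  have hκ : 0 < κbar := by rw [hκbar]; positivity
  have hKc := isCompactOperator_pertOp T α hCc hIc
  obtain ⟨hsurj, ρ, hρ0, hρ⟩ :=
    hKc.one_add_bijective_bound (eq_zero_of_add_pertOp_eq_zero hT Cs Iop hα)
  set K := pertOp T Cs Iop α
  set σ := 1 + ‖K‖ with hσdef
  have hσ0 : 0 ≤ σ := by positivity
  have hσ : ∀ x, ‖x + K x‖ ≤ σ * ‖x‖ := fun x => by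
    have h₁ := norm_add_le x (K x)
    have h₂ := K.le_opNorm x
    rw [hσdef, add_mul, one_mul]
    linarith
  have happ : ∀ x : WithLp 2 (V₁ × V₂), ∀ η > (0 : ℝ), ∀ᶠ h in 𝓝[>] (0 : ℝ),
      ∃ u ∈ prodSubmodule (Vh1 h) (Vh2 h), ‖x - u‖ < η := by
    intro x η hη
    filter_upwards [(happrox (WithLp.ofLp x)).eventually_lt_const hη] with h hh
    obtain ⟨_, ⟨v, hv₁, hv₂, rfl⟩, hlt⟩ := exists_lt_of_csInf_lt
      (show Set.Nonempty {r : ℝ | ∃ vh : V₁ × V₂, vh.1 ∈ Vh1 h ∧ vh.2 ∈ Vh2 h ∧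
        r = nV (WithLp.ofLp x - vh)} from ⟨_, 0, (Vh1 h).zero_mem, (Vh2 h).zero_mem, rfl⟩) hh
    refine ⟨WithLp.toLp 2 v, ⟨hv₁, hv₂⟩, ?_⟩
    rwa [nV_eq_norm_toLp_s8] at hlt
  have hμ' : ∀ h > (0 : ℝ), ∀ [(Vh2 h).HasOrthogonalProjection], 1 / μ h =
      sInf {r : ℝ | ∃ v₁ ∈ Vh1 h, ‖v₁‖ = 1 ∧ r = ‖(Vh2 h).starProjection (T.symm v₁)‖} :=
    fun h hh _ => (hμ h hh).trans (discInfSup_eq_sInf_norm hT _ _)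
  have hlow₁ : ∀ h > (0 : ℝ), ∀ [(Vh2 h).HasOrthogonalProjection], ∀ v ∈ Vh1 h,
      ‖v‖ ≤ μ h * ‖(Vh2 h).starProjection (T.symm v)‖ :=
    fun h hh _ _ => norm_le_mul_norm_starProjection_symm (hμ_pos h hh) (hμ' h hh)
  have hlow : ∀ h > (0 : ℝ), ∀ [FiniteDimensional ℝ (Vh1 h)] [FiniteDimensional ℝ (Vh2 h)],
      ∀ ψ ∈ prodSubmodule (Vh1 h) (Vh2 h),
        ‖ψ‖ ≤ μ h * ‖(prodSubmodule (Vh1 h) (Vh2 h)).starProjection (swapOp T ψ)‖ :=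
    fun h hh _ _ _ => norm_le_mul_norm_starProjection_swapOp (hlow₁ h hh)
      (fun _ => norm_le_mul_norm_starProjection (hμ_pos h hh)
        (fun v₂ hv₂ hz => hndh2 h hh v₂ hv₂ fun φ₁ hφ₁ => (hT φ₁ v₂).trans (hz φ₁ hφ₁))
        (hlow₁ h hh)) (hμ_pos h hh).le
  have hμ1 : ∀ h > (0 : ℝ), 1 ≤ μ h := by
    intro h hh
    have := hfd1 h hh
    have := hfd2 h hh
    obtain ⟨ψ, hψ, hψ1, -⟩ := exists_norm_eq_one_norm_starProjection_swapOp_le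
      (hμ_pos h hh) (hμ' h hh) one_pos
    have h₁ := hlow h hh ψ hψ
    have h₂ := (prodSubmodule (Vh1 h) (Vh2 h)).norm_starProjection_apply_le (swapOp T ψ)
    rw [norm_swapOp_apply, hψ1] at h₂
    rw [hψ1] at h₁
    exact h₁.trans (mul_le_of_le_one_right (hμ_pos h hh).le h₂)
  have hmain : Tendsto (fun h => ν h - μ h) (𝓝[>] (0 : ℝ)) (𝓝 0) := by
    rw [Metric.tendsto_nhds]
    intro ε' hε'
    have hε : 0 < ε' / 2 := half_pos hε'
    set ε := ε' / 2 with hεdef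
    have ht₁ : Tendsto (fun δ : ℝ => (μbar + 1) * ρ * δ * (μbar + ε)) (𝓝[>] 0) (𝓝 0) :=
      tendsto_nhdsWithin_of_tendsto_nhds
        (Continuous.tendsto' (by fun_prop) _ _ (by simp))
    have ht₂ : Tendsto (fun δ : ℝ => σ * ρ * δ + μbar * (1 + σ * ρ) * δ) (𝓝[>] 0) (𝓝 0) :=
      tendsto_nhdsWithin_of_tendsto_nhds
        (Continuous.tendsto' (by fun_prop) _ _ (by simp))
    have ht₃ : Tendsto (fun δ : ℝ => σ * ρ * δ) (𝓝[>] 0) (𝓝 0) :=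
      tendsto_nhdsWithin_of_tendsto_nhds
        (Continuous.tendsto' (by fun_prop) _ _ (by simp))
    obtain ⟨δ, ⟨⟨hδ₁, hδ₂⟩, hδ₃⟩, hδ⟩ := (((ht₁.eventually_le_const hε).and
      (ht₂.eventually_le_const (div_pos hε hμbar))).and
      (ht₃.eventually_lt_const one_pos)).and self_mem_nhdsWithin |>.exists
    filter_upwards [hKc.eventually_uniform_approx (fun h => prodSubmodule (Vh1 h) (Vh2 h)) happ hδ,
      self_mem_nhdsWithin] with h happh hh
    have := hfd1 h hh
    have := hfd2 h hh
    have hle := abs_sSup_ratio_sub_le (norm_swapOp_apply T) hsurj hρ0 hρ hσ0 hσ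
      (Submodule.norm_starProjection_apply_le _) hδ happh (hμ_pos h hh) (hstab h hh) hε
      (hlow h hh)
      (fun η hη => exists_norm_eq_one_norm_starProjection_swapOp_le (hμ_pos h hh) (hμ' h hh) hη)
      hδ₁ hδ₂ hδ₃
    rw [Real.dist_eq, sub_zero, hν h hh, nuConst_eq_sSup_norm hT]
    exact hle.trans_lt (half_lt_self hε')
  refine ⟨fun h => |ν h - μ h| / (κbar * |μ h|), fun h => by positivity, ?_, ?_⟩
  · have h0 : Tendsto (fun h => |ν h - μ h| / κbar) (𝓝[>] (0 : ℝ)) (𝓝 0) := by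
      simpa using hmain.abs.div_const κbar
    refine squeeze_zero' (Eventually.of_forall fun h => by positivity) ?_ h0
    filter_upwards [self_mem_nhdsWithin] with h hh
    have h₁ : κbar ≤ κbar * |μ h| :=
      le_mul_of_one_le_right hκ.le ((hμ1 h hh).trans (le_abs_self _))
    gcongr
  · intro h hh
    simp only [abs_of_pos (hμ_pos h hh)]
    exact (mul_div_cancel₀ _ (mul_pos hκ (hμ_pos h hh)).ne').ge
end
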